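/- For every positive integer ℓ and all reals A_0, …, A_{ℓ−1} > 1, the Hausdorff dimension of S_ℓ(A_0, …, A_{ℓ−1}) equals the Hausdorff dimension of S′_ℓ(A_0, …, A_{ℓ−1}). -/

import Mathlib

open MeasureTheory Filter Set

/-- The Gauss map `T(x) = 1/x - ⌊1/x⌋` (with `T 0 = 0`). -/
noncomputable def gaussMap (x : ℝ) : ℝ := if x = 0 then 0 else Int.fract x⁻¹

/-- `cfA x n` is the `n`-th partial quotient `a_n(x) = ⌊1 / T^{n-1}(x)⌋` (for `n ≥ 1`). -/
noncomputable def cfA (x : ℝ) (n : ℕ) : ℕ := ⌊(gaussMap^[n - 1] x)⁻¹⌋₊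

/-- `cfA' x n` is `a_n(x)` if it is prime, and `0` otherwise. -/
noncomputable def cfA' (x : ℝ) (n : ℕ) : ℕ := if (cfA x n).Prime then cfA x n else 0

/-- `Sℓ ℓ A` is the set of irrational `x ∈ [0,1]` such that for infinitely many `n`,
`A_i^n ≤ a_{n+i}(x) ≤ 2 A_i^n` for every `i ∈ {0, …, ℓ-1}`. -/
noncomputable def Sℓ (ℓ : ℕ) (A : Fin ℓ → ℝ) : Set ℝ :=
  {x | x ∈ Set.Icc (0 : ℝ) 1 ∧ Irrational x ∧
    {n : ℕ | 1 ≤ n ∧ ∀ i : Fin ℓ,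
      A i ^ n ≤ (cfA x (n + (i : ℕ)) : ℝ) ∧ (cfA x (n + (i : ℕ)) : ℝ) ≤ 2 * A i ^ n}.Infinite}

/-- `Sprimeℓ ℓ A` is the set of irrational `x ∈ [0,1]` such that for infinitely many `n`,
`A_i^n ≤ a′_{n+i}(x) ≤ 2 A_i^n` for every `i ∈ {0, …, ℓ-1}`. -/
noncomputable def Sprimeℓ (ℓ : ℕ) (A : Fin ℓ → ℝ) : Set ℝ :=
  {x | x ∈ Set.Icc (0 : ℝ) 1 ∧ Irrational x ∧
    {n : ℕ | 1 ≤ n ∧ ∀ i : Fin ℓ,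
      A i ^ n ≤ (cfA' x (n + (i : ℕ)) : ℝ) ∧ (cfA' x (n + (i : ℕ)) : ℝ) ≤ 2 * A i ^ n}.Infinite}

open scoped ENNReal NNReal Topology

/-- The branch `z ↦ [a₁, …, aₙ + z]` of the inverse of the `n`-th iterate of the Gauss map
attached to the word `a₁ ⋯ aₙ`. -/
noncomputable def cfEval : List ℕ → ℝ → ℝ
  | [], z => z
  | a :: l, z => (a + cfEval l z)⁻¹

/-- The denominator `qₙ + z qₙ₋₁` of the Möbius map `cfEval l`. -/
noncomputable def cfDen : List ℕ → ℝ → ℝ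
  | [], _ => 1
  | a :: l, z => (a + cfEval l z) * cfDen l z

theorem cfEval_append (l l' : List ℕ) (z : ℝ) :
    cfEval (l ++ l') z = cfEval l (cfEval l' z) := by
  induction l with
  | nil => rfl
  | cons a l ih => simp [cfEval, ih]

theorem cfDen_append (l l' : List ℕ) (z : ℝ) :
    cfDen (l ++ l') z = cfDen l (cfEval l' z) * cfDen l' z := by
  induction l with
  | nil => simp [cfDen]
  | cons a l ih => simp [cfDen, ih, cfEval_append, mul_assoc]

theorem cfEval_mem_Icc {l : List ℕ} (hl : ∀ a ∈ l, 1 ≤ a) {z : ℝ} (hz : z ∈ Icc (0 : ℝ) 1) :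
    cfEval l z ∈ Icc (0 : ℝ) 1 := by
  induction l with
  | nil => exact hz
  | cons a l ih =>
    have h := ih fun b hb => hl b (List.mem_cons_of_mem _ hb)
    have ha : (1 : ℝ) ≤ a := by exact_mod_cast hl a List.mem_cons_self
    exact ⟨inv_nonneg.2 (by linarith [h.1]), inv_le_one_of_one_le₀ (by linarith [h.1])⟩

theorem cfEval_mem_Ioc {l : List ℕ} (hl : ∀ a ∈ l, 1 ≤ a) {z : ℝ} (hz : z ∈ Ioc (0 : ℝ) 1) :
    cfEval l z ∈ Ioc (0 : ℝ) 1 := by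
  induction l with
  | nil => exact hz
  | cons a l ih =>
    have h := ih fun b hb => hl b (List.mem_cons_of_mem _ hb)
    have ha : (1 : ℝ) ≤ a := by exact_mod_cast hl a List.mem_cons_self
    exact ⟨inv_pos.2 (by linarith [h.1]), inv_le_one_of_one_le₀ (by linarith [h.1])⟩

theorem cfEval_mem_Ioc_of_ne_nil {l : List ℕ} (hl : ∀ a ∈ l, 1 ≤ a) (hne : l ≠ []) {z : ℝ}
    (hz : z ∈ Icc (0 : ℝ) 1) : cfEval l z ∈ Ioc (0 : ℝ) 1 := by
  obtain ⟨a, l, rfl⟩ := List.exists_cons_of_ne_nil hne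
  have h := cfEval_mem_Icc (l := l) (fun b hb => hl b (List.mem_cons_of_mem _ hb)) hz
  have ha : (1 : ℝ) ≤ a := by exact_mod_cast hl a List.mem_cons_self
  exact ⟨inv_pos.2 (by linarith [h.1]), inv_le_one_of_one_le₀ (by linarith [h.1])⟩

theorem cfEval_mem_Ioo_of_ne_nil {l : List ℕ} (hl : ∀ a ∈ l, 1 ≤ a) (hne : l ≠ []) {z : ℝ}
    (hz : z ∈ Ioc (0 : ℝ) 1) : cfEval l z ∈ Ioo (0 : ℝ) 1 := by
  obtain ⟨a, l, rfl⟩ := List.exists_cons_of_ne_nil hne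
  have h := cfEval_mem_Ioc (l := l) (fun b hb => hl b (List.mem_cons_of_mem _ hb)) hz
  have ha : (1 : ℝ) ≤ a := by exact_mod_cast hl a List.mem_cons_self
  exact ⟨inv_pos.2 (by linarith [h.1]), inv_lt_one_of_one_lt₀ (by linarith [h.1])⟩

theorem prod_le_cfDen {l : List ℕ} (hl : ∀ a ∈ l, 1 ≤ a) {z : ℝ} (hz : z ∈ Icc (0 : ℝ) 1) :
    (l.prod : ℝ) ≤ cfDen l z := by
  induction l with
  | nil => simp [cfDen]
  | cons a l ih =>
    have hl' : ∀ b ∈ l, 1 ≤ b := fun b hb => hl b (List.mem_cons_of_mem _ hb)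
    have h := cfEval_mem_Icc hl' hz
    simp only [List.prod_cons, Nat.cast_mul, cfDen]
    exact mul_le_mul (by linarith [h.1]) (ih hl') (by positivity) (by have := h.1; positivity)

theorem one_le_cfDen {l : List ℕ} (hl : ∀ a ∈ l, 1 ≤ a) {z : ℝ} (hz : z ∈ Icc (0 : ℝ) 1) :
    1 ≤ cfDen l z :=
  le_trans (by exact_mod_cast List.one_le_prod hl) (prod_le_cfDen hl hz)

theorem cfDen_le_two_mul {l : List ℕ} (hl : ∀ a ∈ l, 1 ≤ a) {z w : ℝ} (hz : z ∈ Icc (0 : ℝ) 1)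
    (hw : w ∈ Icc (0 : ℝ) 1) : cfDen l z ≤ 2 * cfDen l w := by
  suffices h : cfDen l z ≤ 2 * cfDen l w ∧
      cfDen l z * (1 + cfEval l z) ≤ 2 * (cfDen l w * (1 + cfEval l w)) from h.1
  induction l with
  | nil => simp only [cfDen, cfEval]; constructor <;> linarith [hz.2, hw.1]
  | cons a l ih =>
    have hl' : ∀ b ∈ l, 1 ≤ b := fun b hb => hl b (List.mem_cons_of_mem _ hb)
    obtain ⟨h1, h2⟩ := ih hl'
    have ha : (1 : ℝ) ≤ a := by exact_mod_cast hl a List.mem_cons_self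
    have hz' := (cfEval_mem_Icc hl' hz).1
    have hw' := (cfEval_mem_Icc hl' hw).1
    have key : cfDen (a :: l) z ≤ 2 * cfDen (a :: l) w := by
      have := mul_le_mul_of_nonneg_left h1 (sub_nonneg.2 ha)
      simp only [cfDen]
      nlinarith
    refine ⟨key, ?_⟩
    have e : ∀ y, 0 ≤ cfEval l y →
        cfDen (a :: l) y * (1 + cfEval (a :: l) y) = cfDen (a :: l) y + cfDen l y := by
      intro y hy
      have : (a : ℝ) + cfEval l y ≠ 0 := by positivity
      simp only [cfDen, cfEval]
      field_simp
    rw [e z hz', e w hw']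
    linarith

theorem cfDen_append_le {l l' : List ℕ} (hl : ∀ a ∈ l, 1 ≤ a) (hl' : ∀ a ∈ l', 1 ≤ a) :
    cfDen (l ++ l') 0 ≤ 2 * (cfDen l 0 * cfDen l' 0) := by
  have h0 : (0 : ℝ) ∈ Icc (0 : ℝ) 1 := by simp
  rw [cfDen_append, ← mul_assoc]
  exact mul_le_mul_of_nonneg_right (cfDen_le_two_mul hl (cfEval_mem_Icc hl' h0) h0)
    (zero_le_one.trans (one_le_cfDen hl' h0))

theorem le_cfDen_append {l l' : List ℕ} (hl : ∀ a ∈ l, 1 ≤ a) (hl' : ∀ a ∈ l', 1 ≤ a) :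
    cfDen l 0 * cfDen l' 0 ≤ 2 * cfDen (l ++ l') 0 := by
  have h0 : (0 : ℝ) ∈ Icc (0 : ℝ) 1 := by simp
  rw [cfDen_append, ← mul_assoc]
  exact mul_le_mul_of_nonneg_right (cfDen_le_two_mul hl h0 (cfEval_mem_Icc hl' h0))
    (zero_le_one.trans (one_le_cfDen hl' h0))

theorem two_pow_le_cfDen {l : List ℕ} (hl : ∀ a ∈ l, 1 ≤ a) {z : ℝ} (hz : z ∈ Icc (0 : ℝ) 1) :
    (2 : ℝ) ^ (l.length / 2) ≤ cfDen l z := by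
  induction l using List.twoStepInduction with
  | nil => simp [cfDen]
  | singleton a => simpa using one_le_cfDen hl hz
  | cons_cons a b l ih _ =>
    have hl' : ∀ c ∈ l, 1 ≤ c := fun c hc => hl c (by simp [hc])
    have h := ih hl'
    have ha : (1 : ℝ) ≤ a := by exact_mod_cast hl a (by simp)
    have hb : (1 : ℝ) ≤ b := by exact_mod_cast hl b (by simp)
    have h0 := (cfEval_mem_Icc hl' hz).1
    have hlen : (a :: b :: l).length / 2 = l.length / 2 + 1 := by simp; omega
    have hne : (b : ℝ) + cfEval l z ≠ 0 := by positivity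
    have e : cfDen (a :: b :: l) z = (a * (b + cfEval l z) + 1) * cfDen l z := by
      simp only [cfDen, cfEval]
      field_simp
    rw [hlen, e, pow_succ]
    have : (2 : ℝ) ≤ a * (b + cfEval l z) + 1 := by nlinarith
    have hD := one_le_cfDen hl' hz
    nlinarith

theorem abs_cfEval_sub {l : List ℕ} (hl : ∀ a ∈ l, 1 ≤ a) {z w : ℝ} (hz : z ∈ Icc (0 : ℝ) 1)
    (hw : w ∈ Icc (0 : ℝ) 1) :
    |cfEval l z - cfEval l w| = |z - w| / (cfDen l z * cfDen l w) := by
  induction l with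
  | nil => simp [cfEval, cfDen]
  | cons a l ih =>
    have hl' : ∀ b ∈ l, 1 ≤ b := fun b hb => hl b (List.mem_cons_of_mem _ hb)
    have ha : (1 : ℝ) ≤ a := by exact_mod_cast hl a List.mem_cons_self
    have hz' := (cfEval_mem_Icc hl' hz).1
    have hw' := (cfEval_mem_Icc hl' hw).1
    have hz0 : 0 < (a : ℝ) + cfEval l z := by positivity
    have hw0 : 0 < (a : ℝ) + cfEval l w := by positivity
    have h1 := one_le_cfDen hl' hz
    have h2 := one_le_cfDen hl' hw
    simp only [cfEval, cfDen]
    rw [inv_sub_inv hz0.ne' hw0.ne', abs_div, abs_of_pos (mul_pos hz0 hw0),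
      show (a : ℝ) + cfEval l w - (a + cfEval l z) = -(cfEval l z - cfEval l w) by ring,
      abs_neg, ih hl', div_div]
    congr 1
    ring

theorem abs_cfEval_sub_le {l : List ℕ} (hl : ∀ a ∈ l, 1 ≤ a) {z w : ℝ} (hz : z ∈ Icc (0 : ℝ) 1)
    (hw : w ∈ Icc (0 : ℝ) 1) :
    |cfEval l z - cfEval l w| ≤ 4 * |z - w| / cfDen l 0 ^ 2 := by
  have h0 : (0 : ℝ) ∈ Icc (0 : ℝ) 1 := by simp
  have h1 := one_le_cfDen hl h0
  have h2 := one_le_cfDen hl hz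
  have h3 := one_le_cfDen hl hw
  have h4 := cfDen_le_two_mul hl h0 hz
  have h5 := cfDen_le_two_mul hl h0 hw
  rw [abs_cfEval_sub hl hz hw, div_le_div_iff₀ (by positivity) (by positivity)]
  have : cfDen l 0 ^ 2 ≤ 4 * (cfDen l z * cfDen l w) := by nlinarith
  nlinarith [mul_le_mul_of_nonneg_left this (abs_nonneg (z - w))]

theorem le_abs_cfEval_sub {l : List ℕ} (hl : ∀ a ∈ l, 1 ≤ a) {z w : ℝ} (hz : z ∈ Icc (0 : ℝ) 1)
    (hw : w ∈ Icc (0 : ℝ) 1) :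
    |z - w| / (4 * cfDen l 0 ^ 2) ≤ |cfEval l z - cfEval l w| := by
  have h0 : (0 : ℝ) ∈ Icc (0 : ℝ) 1 := by simp
  have h1 := one_le_cfDen hl h0
  have h2 := one_le_cfDen hl hz
  have h3 := one_le_cfDen hl hw
  have h4 := cfDen_le_two_mul hl hz h0
  have h5 := cfDen_le_two_mul hl hw h0
  rw [abs_cfEval_sub hl hz hw]
  refine div_le_div_of_nonneg_left (abs_nonneg _) (by positivity) ?_
  calc cfDen l z * cfDen l w ≤ (2 * cfDen l 0) * (2 * cfDen l 0) := by gcongr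
    _ = _ := by ring

theorem cfEval_injective_Icc {l : List ℕ} (hl : ∀ a ∈ l, 1 ≤ a) :
    InjOn (cfEval l) (Icc (0 : ℝ) 1) := by
  intro z hz w hw h
  have h1 := le_abs_cfEval_sub hl hz hw
  have h0 : 1 ≤ cfDen l 0 := one_le_cfDen hl (by simp)
  rw [h, sub_self, abs_zero, div_le_iff₀ (by positivity), zero_mul] at h1
  exact sub_eq_zero.1 (abs_nonpos_iff.1 h1)

theorem continuousOn_cfEval {l : List ℕ} (hl : ∀ a ∈ l, 1 ≤ a) :
    ContinuousOn (cfEval l) (Icc (0 : ℝ) 1) := by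
  refine (LipschitzOnWith.of_dist_le_mul (K := 4) fun z hz w hw => ?_).continuousOn
  have h1 := one_le_cfDen hl (z := 0) (by simp)
  rw [Real.dist_eq, Real.dist_eq]
  refine (abs_cfEval_sub_le hl hz hw).trans (div_le_self (by positivity) ?_)
  exact one_le_pow₀ h1

/-- Words of the same length with a common value at points of `(0, 1]` coincide. -/
theorem eq_of_cfEval_eq {l l' : List ℕ} (hl : ∀ a ∈ l, 1 ≤ a) (hl' : ∀ a ∈ l', 1 ≤ a)
    (hlen : l.length = l'.length) {z w : ℝ} (hz : z ∈ Ioc (0 : ℝ) 1) (hw : w ∈ Ioc (0 : ℝ) 1)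
    (h : cfEval l z = cfEval l' w) : l = l' := by
  induction l generalizing l' with
  | nil => exact (List.length_eq_zero_iff.1 hlen.symm).symm
  | cons a l ih =>
    obtain ⟨b, l', rfl⟩ := List.exists_cons_of_length_eq_add_one hlen.symm
    have h1 : ∀ c ∈ l, 1 ≤ c := fun c hc => hl c (List.mem_cons_of_mem _ hc)
    have h2 : ∀ c ∈ l', 1 ≤ c := fun c hc => hl' c (List.mem_cons_of_mem _ hc)
    have hz' := cfEval_mem_Ioc h1 hz
    have hw' := cfEval_mem_Ioc h2 hw
    simp only [cfEval, inv_inj] at h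
    have hab : a = b := by
      have e1 : (a : ℝ) < b + 1 := by linarith [hz'.1, hw'.2]
      have e2 : (b : ℝ) < a + 1 := by linarith [hw'.1, hz'.2]
      norm_cast at e1 e2
      omega
    subst hab
    rw [ih h1 h2 (by simpa using hlen) (by linarith)]

theorem gaussMap_inv_add {a : ℕ} {z : ℝ} (hz : z ∈ Ioo (0 : ℝ) 1) :
    gaussMap ((a : ℝ) + z)⁻¹ = z := by
  have : (a : ℝ) + z ≠ 0 := by have := hz.1; positivity
  rw [gaussMap, if_neg (inv_ne_zero this), inv_inv, Int.fract_natCast_add,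
    Int.fract_eq_self.2 ⟨hz.1.le, hz.2⟩]

theorem cfEval_mem_Ioo {l : List ℕ} (hl : ∀ a ∈ l, 1 ≤ a) {z : ℝ} (hz : z ∈ Ioo (0 : ℝ) 1) :
    cfEval l z ∈ Ioo (0 : ℝ) 1 := by
  rcases eq_or_ne l [] with rfl | hne
  · exact hz
  · exact cfEval_mem_Ioo_of_ne_nil hl hne ⟨hz.1, hz.2.le⟩

theorem gaussMap_iterate_cfEval {l : List ℕ} (hl : ∀ a ∈ l, 1 ≤ a) {z : ℝ}
    (hz : z ∈ Ioo (0 : ℝ) 1) : gaussMap^[l.length] (cfEval l z) = z := by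
  induction l with
  | nil => rfl
  | cons a l ih =>
    have h1 : ∀ c ∈ l, 1 ≤ c := fun c hc => hl c (List.mem_cons_of_mem _ hc)
    rw [List.length_cons, Function.iterate_succ_apply, cfEval,
      gaussMap_inv_add (cfEval_mem_Ioo h1 hz), ih h1]

theorem cfA_cfEval_append {l l' : List ℕ} {b : ℕ} (hl : ∀ a ∈ l ++ b :: l', 1 ≤ a) {z : ℝ}
    (hz : z ∈ Ioo (0 : ℝ) 1) : cfA (cfEval (l ++ b :: l') z) (l.length + 1) = b := by
  have h1 : ∀ c ∈ l', 1 ≤ c := fun c hc => hl c (by simp [hc])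
  have h2 := cfEval_mem_Ioo h1 hz
  rw [cfA, Nat.add_sub_cancel, cfEval_append,
    gaussMap_iterate_cfEval (fun c hc => hl c (by simp [hc]))
      (cfEval_mem_Ioo (fun c hc => hl c (List.mem_append_right _ hc)) hz), cfEval, inv_inv,
    Nat.floor_eq_iff (by have := h2.1; positivity)]
  exact ⟨by linarith [h2.1], by linarith [h2.2]⟩

theorem exists_gaussMap_iterate_eq_zero (q : ℕ) :
    ∀ p < q, ∃ n, gaussMap^[n] ((p : ℝ) / q) = 0 := by
  induction q using Nat.strong_induction_on with
  | _ q ih =>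
    intro p hp
    rcases Nat.eq_zero_or_pos p with rfl | hp0
    · exact ⟨0, by simp⟩
    · obtain ⟨n, hn⟩ := ih p hp (q % p) (Nat.mod_lt _ hp0)
      refine ⟨n + 1, ?_⟩
      have : (p : ℝ) / q ≠ 0 := by
        have : 0 < q := hp0.trans hp
        positivity
      rw [Function.iterate_succ_apply, gaussMap, if_neg this, inv_div,
        Int.fract_div_natCast_eq_div_natCast_mod, hn]

theorem irrational_of_gaussMap_iterate_ne_zero {x : ℝ} (hx : x ∈ Ioo (0 : ℝ) 1)
    (h : ∀ n, gaussMap^[n] x ≠ 0) : Irrational x := by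
  rintro ⟨r, rfl⟩
  have hr0 : 0 < r := by exact_mod_cast hx.1
  have hr1 : r < 1 := by exact_mod_cast hx.2
  have hnum : ((r.num.toNat : ℤ)) = r.num := Int.toNat_of_nonneg (Rat.num_nonneg.2 hr0.le)
  have e : (r : ℝ) = (r.num.toNat : ℝ) / r.den := by
    rw [show ((r.num.toNat : ℕ) : ℝ) = r.num by rw [← Int.cast_natCast, hnum], ← Rat.cast_def]
  have hlt : r.num.toNat < r.den := by
    have := Rat.num_lt_denom_iff.2 hr1
    omega
  obtain ⟨n, hn⟩ := exists_gaussMap_iterate_eq_zero r.den _ hlt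
  exact h n (e ▸ hn)

theorem irrational_gaussMap_iterate {x : ℝ} (hx : x ∈ Ioo (0 : ℝ) 1) (hirr : Irrational x)
    (n : ℕ) : gaussMap^[n] x ∈ Ioo (0 : ℝ) 1 ∧ Irrational (gaussMap^[n] x) := by
  induction n with
  | zero => exact ⟨hx, hirr⟩
  | succ n ih =>
    rw [Function.iterate_succ_apply', gaussMap, if_neg ih.1.1.ne']
    have hirr' : Irrational (Int.fract (gaussMap^[n] x)⁻¹) := by
      rw [Int.fract]
      exact ih.2.inv.sub_intCast _
    exact ⟨⟨(Int.fract_nonneg _).lt_of_ne' hirr'.ne_zero, Int.fract_lt_one _⟩, hirr'⟩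

theorem cfA_add_gaussMap_iterate {x : ℝ} (hx : x ∈ Ioo (0 : ℝ) 1) (hirr : Irrational x) (n : ℕ) :
    gaussMap^[n] x = (cfA x (n + 1) + gaussMap^[n + 1] x)⁻¹ := by
  have h := (irrational_gaussMap_iterate hx hirr n).1
  rw [Function.iterate_succ_apply', gaussMap, if_neg h.1.ne', cfA, Nat.add_sub_cancel,
    natCast_floor_eq_intCast_floor (inv_nonneg.2 h.1.le), Int.floor_add_fract, inv_inv]

theorem one_le_cfA {x : ℝ} (hx : x ∈ Ioo (0 : ℝ) 1) (hirr : Irrational x) (n : ℕ) :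
    1 ≤ cfA x (n + 1) := by
  have h := (irrational_gaussMap_iterate hx hirr n).1
  rw [cfA, Nat.add_sub_cancel]
  exact Nat.le_floor (by simpa using (one_lt_inv₀ h.1).2 h.2 |>.le)

theorem eq_cfEval_ofFn {x : ℝ} (hx : x ∈ Ioo (0 : ℝ) 1) (hirr : Irrational x) (m n : ℕ) :
    gaussMap^[m] x =
      cfEval (List.ofFn fun i : Fin n => cfA x (m + i + 1)) (gaussMap^[m + n] x) := by
  induction n generalizing m with
  | zero => simp [cfEval]
  | succ n ih =>
    rw [List.ofFn_succ, cfEval, cfA_add_gaussMap_iterate hx hirr m, ih (m + 1)]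
    simp [add_assoc, add_comm 1]

theorem cfEval_nonneg (l : List ℕ) : 0 ≤ cfEval l 0 := by
  induction l with
  | nil => exact le_rfl
  | cons a l ih => rw [cfEval]; positivity

theorem cfDen_nonneg (l : List ℕ) : 0 ≤ cfDen l 0 := by
  induction l with
  | nil => exact zero_le_one
  | cons a l ih =>
    have := cfEval_nonneg l
    rw [cfDen]; positivity

/-- The concatenation `a 0 ++ ⋯ ++ a (m - 1)` of the first `m` words of a sequence of words. -/
def wordPrefix (a : ℕ → List ℕ) : ℕ → List ℕ
  | 0 => []
  | m + 1 => wordPrefix a m ++ a m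

theorem one_le_of_mem_wordPrefix {a : ℕ → List ℕ} (ha : ∀ m, ∀ b ∈ a m, 1 ≤ b) (m : ℕ) :
    ∀ b ∈ wordPrefix a m, 1 ≤ b := by
  induction m with
  | zero => simp [wordPrefix]
  | succ m ih =>
    intro b hb
    rcases List.mem_append.1 hb with hb | hb
    exacts [ih b hb, ha m b hb]

theorem le_length_wordPrefix {a : ℕ → List ℕ} (ha : ∀ m, a m ≠ []) (m : ℕ) :
    m ≤ (wordPrefix a m).length := by
  induction m with
  | zero => simp
  | succ m ih =>
    have := List.length_pos_iff.2 (ha m)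
    simp only [wordPrefix, List.length_append]
    omega

theorem wordPrefix_congr {a b : ℕ → List ℕ} {m : ℕ} (h : ∀ i < m, a i = b i) :
    wordPrefix a m = wordPrefix b m := by
  induction m with
  | zero => rfl
  | succ m ih =>
    rw [wordPrefix, wordPrefix, ih fun i hi => h i (hi.trans m.lt_succ_self), h m m.lt_succ_self]

/-- Every infinite concatenation of words is the continued fraction expansion of an irrational. -/
theorem exists_irrational_forall_eq_cfEval {a : ℕ → List ℕ} (hne : ∀ m, a m ≠ [])
    (ha : ∀ m, ∀ b ∈ a m, 1 ≤ b) :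
    ∃ x ∈ Ioo (0 : ℝ) 1, Irrational x ∧
      ∀ m, ∃ z ∈ Ioo (0 : ℝ) 1, x = cfEval (wordPrefix a m) z := by
  have hpre := one_le_of_mem_wordPrefix ha
  obtain ⟨x, hx⟩ := IsCompact.nonempty_iInter_of_sequence_nonempty_isCompact_isClosed
    (fun m => cfEval (wordPrefix a m) '' Icc (0 : ℝ) 1)
    (fun m => by
      rintro _ ⟨z, hz, rfl⟩
      exact ⟨cfEval (a m) z, cfEval_mem_Icc (ha m) hz, by rw [wordPrefix, cfEval_append]⟩)
    (fun m => ⟨_, mem_image_of_mem _ (by simp : (0 : ℝ) ∈ Icc (0 : ℝ) 1)⟩)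
    (isCompact_Icc.image_of_continuousOn (continuousOn_cfEval (hpre 0)))
    (fun m => (isCompact_Icc.image_of_continuousOn (continuousOn_cfEval (hpre m))).isClosed)
  rw [mem_iInter] at hx
  choose z hz hxz using hx
  have hstep : ∀ m, z m = cfEval (a m) (z (m + 1)) := fun m =>
    cfEval_injective_Icc (hpre m) (hz m) (cfEval_mem_Icc (ha m) (hz _))
      (by rw [← cfEval_append, hxz m]; exact (hxz (m + 1)).symm)
  have hIoc : ∀ m, z m ∈ Ioc (0 : ℝ) 1 := fun m =>
    hstep m ▸ cfEval_mem_Ioc_of_ne_nil (ha m) (hne m) (hz _)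
  have hIoo : ∀ m, z m ∈ Ioo (0 : ℝ) 1 := fun m =>
    hstep m ▸ cfEval_mem_Ioo_of_ne_nil (ha m) (hne m) (hIoc _)
  have hx0 : x = z 0 := (hxz 0).symm
  refine ⟨x, hx0 ▸ hIoo 0, irrational_of_gaussMap_iterate_ne_zero (hx0 ▸ hIoo 0) fun n hn => ?_,
    fun m => ⟨z m, hIoo m, (hxz m).symm⟩⟩
  have h1 : gaussMap^[(wordPrefix a n).length] x = z n := by
    rw [← hxz n, gaussMap_iterate_cfEval (hpre n) (hIoo n)]
  have h2 : gaussMap 0 = 0 := if_pos rfl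
  rw [← Nat.sub_add_cancel (le_length_wordPrefix hne n), Function.iterate_add_apply, hn,
    Function.iterate_fixed h2] at h1
  exact (hIoo n).1.ne h1

section MassDistribution

variable {𝒜 : ℕ → Finset (List ℕ)} {w : ℕ → List ℕ → ℝ} {r : ℕ → ℝ} {t : ℝ}

theorem prod_weight_mul_cfDen_le (ht : 0 ≤ t)
    (hA : ∀ m, ∀ v ∈ 𝒜 m, v ≠ [] ∧ ∀ a ∈ v, 1 ≤ a) (hw0 : ∀ m v, 0 ≤ w m v) (hr0 : r 0 = 1)
    (hr : ∀ m, ∀ v ∈ 𝒜 m, r m * (w m v * (2 * cfDen v 0) ^ (2 * t)) ≤ r (m + 1))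
    {a : ℕ → List ℕ} (ha : ∀ m, a m ∈ 𝒜 m) (m : ℕ) :
    (∏ i ∈ Finset.range m, w i (a i)) * cfDen (wordPrefix a m) 0 ^ (2 * t) ≤ r m := by
  have h0 : (0 : ℝ) ∈ Icc (0 : ℝ) 1 := by simp
  have hl : ∀ m, ∀ b ∈ a m, 1 ≤ b := fun m => (hA m _ (ha m)).2
  induction m with
  | zero => simp [wordPrefix, cfDen, hr0]
  | succ m ih =>
    have hq := one_le_cfDen (one_le_of_mem_wordPrefix hl m) h0
    have hv := one_le_cfDen (hl m) h0
    have hP : 0 ≤ ∏ i ∈ Finset.range m, w i (a i) := Finset.prod_nonneg fun i _ => hw0 i _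
    have hq' : 0 ≤ cfDen (wordPrefix a (m + 1)) 0 :=
      zero_le_one.trans (one_le_cfDen (one_le_of_mem_wordPrefix hl (m + 1)) h0)
    have hle : cfDen (wordPrefix a (m + 1)) 0 ^ (2 * t) ≤
        cfDen (wordPrefix a m) 0 ^ (2 * t) * (2 * cfDen (a m) 0) ^ (2 * t) := by
      rw [← Real.mul_rpow (by positivity) (by positivity)]
      refine Real.rpow_le_rpow hq' ?_ (by positivity)
      exact (cfDen_append_le (one_le_of_mem_wordPrefix hl m) (hl m)).trans_eq (by ring)
    calc _ ≤ (∏ i ∈ Finset.range (m + 1), w i (a i)) *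
          (cfDen (wordPrefix a m) 0 ^ (2 * t) * (2 * cfDen (a m) 0) ^ (2 * t)) :=
          mul_le_mul_of_nonneg_left hle (Finset.prod_nonneg fun i _ => hw0 i _)
      _ = ((∏ i ∈ Finset.range m, w i (a i)) * cfDen (wordPrefix a m) 0 ^ (2 * t)) *
          (w m (a m) * (2 * cfDen (a m) 0) ^ (2 * t)) := by
          rw [Finset.prod_range_succ]; ring
      _ ≤ r m * (w m (a m) * (2 * cfDen (a m) 0) ^ (2 * t)) :=
          mul_le_mul_of_nonneg_right ih (mul_nonneg (hw0 _ _) (by positivity))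
      _ ≤ _ := hr m _ (ha m)

theorem tendsto_prod_weight (ht : 0 < t)
    (hA : ∀ m, ∀ v ∈ 𝒜 m, v ≠ [] ∧ ∀ a ∈ v, 1 ≤ a) (hw0 : ∀ m v, 0 ≤ w m v) (hr0 : r 0 = 1)
    (hr : ∀ m, ∀ v ∈ 𝒜 m, r m * (w m v * (2 * cfDen v 0) ^ (2 * t)) ≤ r (m + 1))
    (hr1 : ∀ m, r m ≤ 1) {a : ℕ → List ℕ} (ha : ∀ m, a m ∈ 𝒜 m) :
    Tendsto (fun m => ∏ i ∈ Finset.range m, w i (a i)) atTop (𝓝 0) := by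
  have h0 : (0 : ℝ) ∈ Icc (0 : ℝ) 1 := by simp
  have hl : ∀ m, ∀ b ∈ a m, 1 ≤ b := fun m => (hA m _ (ha m)).2
  have hpow : Tendsto (fun m : ℕ => (2 : ℝ) ^ (m / 2)) atTop atTop :=
    (tendsto_pow_atTop_atTop_of_one_lt one_lt_two).comp
      (Nat.tendsto_div_const_atTop two_ne_zero)
  have hq : Tendsto (fun m => cfDen (wordPrefix a m) 0) atTop atTop :=
    tendsto_atTop_mono (fun m => (pow_le_pow_right₀ one_le_two (Nat.div_le_div_right
      (le_length_wordPrefix (fun m => (hA m _ (ha m)).1) m))).trans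
      (two_pow_le_cfDen (one_le_of_mem_wordPrefix hl m) h0)) hpow
  refine squeeze_zero (fun m => Finset.prod_nonneg fun i _ => hw0 i _) (fun m => ?_)
    ((tendsto_rpow_atTop (by positivity : 0 < 2 * t)).comp hq).inv_tendsto_atTop
  have h1 := one_le_cfDen (one_le_of_mem_wordPrefix hl m) h0
  simp only [Pi.inv_apply, Function.comp_apply]
  rw [← one_div, le_div_iff₀ (by positivity)]
  exact (prod_weight_mul_cfDen_le ht.le hA hw0 hr0 hr ha m).trans (hr1 m)

/-- A mass distribution principle for sets of continued fractions built from independent random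
words: `r m` bounds the mass of a cylinder of generation `m` normalised by the `t`-th power of
its length. -/
theorem le_dimH_of_forall_words_mem {s : ℝ≥0} {C : ℝ} {X : Set ℝ} (hst : (s : ℝ) = t) (ht : 0 < t)
    (hC : 0 < C) (hA : ∀ m, ∀ v ∈ 𝒜 m, v ≠ [] ∧ ∀ a ∈ v, 1 ≤ a) (hw0 : ∀ m v, 0 ≤ w m v)
    (hw1 : ∀ m, ∑ v ∈ 𝒜 m, w m v = 1) (hr0 : r 0 = 1)
    (hr : ∀ m, ∀ v ∈ 𝒜 m, r m * (w m v * (2 * cfDen v 0) ^ (2 * t)) ≤ r (m + 1))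
    (hr1 : ∀ m, r m ≤ 1)
    (hsep : ∀ m, ∀ B ⊆ 𝒜 m, B.Nontrivial → ∃ v ∈ B, ∃ v' ∈ B, ∀ z ∈ Icc (0 : ℝ) 1,
      ∀ z' ∈ Icc (0 : ℝ) 1, r m * ∑ u ∈ B, w m u ≤ C * |cfEval v z - cfEval v' z'| ^ t)
    (hX : ∀ a : ℕ → List ℕ, (∀ m, a m ∈ 𝒜 m) → ∀ x ∈ Ioo (0 : ℝ) 1, Irrational x →
      (∀ m, ∃ z ∈ Ioo (0 : ℝ) 1, x = cfEval (wordPrefix a m) z) → x ∈ X) :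
    (s : ℝ≥0∞) ≤ dimH X := by
  classical
  let _ : ∀ m, MeasurableSpace (𝒜 m) := fun _ => ⊤
  have : ∀ m, DiscreteMeasurableSpace (𝒜 m) := fun _ => ⟨fun _ => trivial⟩
  let μ : ∀ m, Measure (𝒜 m) := fun m =>
    ∑ v : 𝒜 m, ENNReal.ofReal (w m v) • Measure.dirac v
  have hμB : ∀ m (B : Finset (𝒜 m)), μ m B = ENNReal.ofReal (∑ v ∈ B, w m v) := by
    intro m B
    rw [ENNReal.ofReal_sum_of_nonneg (fun v _ => hw0 m _)]
    simp only [μ, Measure.coe_finsetSum, Finset.sum_apply, Measure.smul_apply, smul_eq_mul,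
      Measure.dirac_apply, Set.indicator_apply, Finset.mem_coe, Pi.one_apply, mul_ite, mul_one,
      mul_zero, Finset.sum_ite_mem, Finset.univ_inter]
  have : ∀ m, IsProbabilityMeasure (μ m) := fun m => ⟨by
    rw [← Finset.coe_univ, hμB, Finset.sum_coe_sort (𝒜 m) (w m), hw1, ENNReal.ofReal_one]⟩
  let P := Measure.infinitePi μ
  have hword : ∀ ω : (∀ m, 𝒜 m), ∀ m, (ω m : List ℕ) ∈ 𝒜 m := fun ω m => (ω m).2
  have hl : ∀ (ω : ∀ m, 𝒜 m) (m), ∀ b ∈ (ω m : List ℕ), 1 ≤ b := fun ω m =>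
    (hA m _ (hword ω m)).2
  choose f hf01 hfirr hf using fun ω : (∀ m, 𝒜 m) =>
    exists_irrational_forall_eq_cfEval (a := fun m => (ω m : List ℕ))
      (fun m => (hA m _ (hword ω m)).1) (hl ω)
  have hcyl : ∀ (ω : ∀ m, 𝒜 m) (m : ℕ) (B : Finset (𝒜 m)),
      P {ω' | (∀ i < m, ω' i = ω i) ∧ ω' m ∈ B} ≤
        ENNReal.ofReal ((∏ i ∈ Finset.range m, w i (ω i)) * ∑ v ∈ B, w m v) := by
    intro ω m B
    let D : ∀ i, Set (𝒜 i) := fun i => {v | (i < m → v = ω i) ∧ ∀ h : i = m, (h ▸ v) ∈ B}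
    have hsub : {ω' | (∀ i < m, ω' i = ω i) ∧ ω' m ∈ B} ⊆
        Set.pi (Finset.range (m + 1)) D := by
      rintro ω' ⟨h1, h2⟩ i -
      exact ⟨h1 i, fun h => by subst h; exact h2⟩
    refine (measure_mono hsub).trans_eq ?_
    have hDm : D m = B := by ext v; simp [D]
    have hDi : ∀ i ∈ Finset.range m, μ i (D i) = ENNReal.ofReal (w i (ω i)) := by
      intro i hi
      have hi := Finset.mem_range.1 hi
      have : D i = (({ω i} : Finset (𝒜 i)) : Set (𝒜 i)) := by
        ext v
        simp [D, hi, hi.ne]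
      rw [this, hμB, Finset.sum_singleton]
    rw [Measure.infinitePi_pi _ (fun _ _ => MeasurableSet.of_discrete), Finset.prod_range_succ,
      Finset.prod_congr rfl hDi, hDm, hμB, ← ENNReal.ofReal_prod_of_nonneg fun i _ => hw0 _ _,
      ENNReal.ofReal_mul (Finset.prod_nonneg fun i _ => hw0 _ _)]
  have hball : ∀ U : Set ℝ, P (f ⁻¹' U) ≤ ENNReal.ofReal (C * 4 ^ t) * Metric.ediam U ^ t := by
    intro U
    by_cases hU : (f ⁻¹' U).Subsingleton
    · rcases hU.eq_empty_or_singleton with h | ⟨ω, h⟩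
      · simp [h]
      · have : P (f ⁻¹' U) ≤ 0 := by
          rw [h]
          have hlim := ENNReal.tendsto_ofReal
            (tendsto_prod_weight ht hA hw0 hr0 hr hr1 (hword ω))
          rw [ENNReal.ofReal_zero] at hlim
          refine ge_of_tendsto' hlim fun m => ?_
          refine (measure_mono ?_).trans ((hcyl ω m Finset.univ).trans_eq ?_)
          · rintro ω' rfl
            simp
          · rw [Finset.sum_coe_sort (𝒜 m) (w m), hw1, mul_one]
        exact this.trans zero_le
    · have hex : ∃ m, ∃ ω ∈ f ⁻¹' U, ∃ ω' ∈ f ⁻¹' U, ω m ≠ ω' m := by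
        by_contra! hcon
        exact hU fun ω h ω' h' => funext fun m => hcon m ω h ω' h'
      let m := Nat.find hex
      obtain ⟨ω₀, hω₀, ω₁, hω₁, hne⟩ := Nat.find_spec hex
      have hmin : ∀ i < m, ∀ ω ∈ f ⁻¹' U, ω i = ω₀ i := by
        intro i hi ω hω
        by_contra hcon
        exact Nat.find_min hex hi ⟨ω, hω, ω₀, hω₀, hcon⟩
      let B : Finset (𝒜 m) := Finset.univ.filter fun v => ∃ ω ∈ f ⁻¹' U, ω m = v
      have hB : ∀ ω ∈ f ⁻¹' U, ω m ∈ B := fun ω hω =>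
        Finset.mem_filter.2 ⟨Finset.mem_univ _, ω, hω, rfl⟩
      obtain ⟨v, hv, v', hv', hsep⟩ := hsep m (B.map (Function.Embedding.subtype _))
        (fun u hu => by
          obtain ⟨u', -, rfl⟩ := Finset.mem_map.1 hu
          exact u'.2)
        ((Finset.map_nontrivial).2 ⟨ω₀ m, hB _ hω₀, ω₁ m, hB _ hω₁, hne⟩)
      obtain ⟨u, hu, rfl⟩ := Finset.mem_map.1 hv
      obtain ⟨u', hu', rfl⟩ := Finset.mem_map.1 hv'
      obtain ⟨ω, hω, rfl⟩ := (Finset.mem_filter.1 hu).2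
      obtain ⟨ω', hω', rfl⟩ := (Finset.mem_filter.1 hu').2
      rw [Finset.sum_map] at hsep
      obtain ⟨z, hz, hxz⟩ := hf ω (m + 1)
      obtain ⟨z', hz', hxz'⟩ := hf ω' (m + 1)
      have hzI := Ioo_subset_Icc_self hz
      have hzI' := Ioo_subset_Icc_self hz'
      have hsep := hsep z hzI z' hzI'
      set p := wordPrefix (fun m => (ω₀ m : List ℕ)) m with hp
      have hp1 : ∀ b ∈ p, 1 ≤ b := one_le_of_mem_wordPrefix (hl ω₀) m
      rw [wordPrefix, wordPrefix_congr (b := fun m => (ω₀ m : List ℕ))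
        (fun i hi => congrArg Subtype.val (hmin i hi ω hω)), ← hp, cfEval_append] at hxz
      rw [wordPrefix, wordPrefix_congr (b := fun m => (ω₀ m : List ℕ))
        (fun i hi => congrArg Subtype.val (hmin i hi ω' hω')), ← hp, cfEval_append] at hxz'
      have hq := one_le_cfDen hp1 (z := 0) (by simp)
      have hdist : |cfEval (ω m) z - cfEval (ω' m) z'| ≤ 4 * cfDen p 0 ^ 2 * |f ω - f ω'| := by
        have := le_abs_cfEval_sub hp1 (cfEval_mem_Icc (hl ω m) hzI)
          (cfEval_mem_Icc (hl ω' m) hzI')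
        rw [← hxz, ← hxz', div_le_iff₀ (by positivity)] at this
        linarith
      have hmass := prod_weight_mul_cfDen_le ht.le hA hw0 hr0 hr (hword ω₀) m
      have hQ : 0 < cfDen p 0 ^ (2 * t) := by positivity
      have hmain : (∏ i ∈ Finset.range m, w i (ω₀ i)) * ∑ u ∈ B, w m u ≤
          C * 4 ^ t * |f ω - f ω'| ^ t := by
        refine le_of_mul_le_mul_right ?_ hQ
        calc _ = ((∏ i ∈ Finset.range m, w i (ω₀ i)) * cfDen p 0 ^ (2 * t)) *
              ∑ u ∈ B, w m u := by ring
          _ ≤ r m * ∑ u ∈ B, w m u :=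
              mul_le_mul_of_nonneg_right hmass (Finset.sum_nonneg fun u _ => hw0 _ _)
          _ ≤ C * |cfEval (ω m) z - cfEval (ω' m) z'| ^ t := hsep
          _ ≤ C * (4 * cfDen p 0 ^ 2 * |f ω - f ω'|) ^ t := by gcongr
          _ = _ := by
              rw [Real.mul_rpow (by positivity) (abs_nonneg _),
                Real.mul_rpow (by positivity) (by positivity), ← Real.rpow_natCast,
                ← Real.rpow_mul (by positivity)]
              push_cast
              ring
      have hVsub : f ⁻¹' U ⊆ {ω | (∀ i < m, ω i = ω₀ i) ∧ ω m ∈ B} := fun ω hω =>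
        ⟨fun i hi => hmin i hi ω hω, hB ω hω⟩
      refine (measure_mono hVsub).trans ((hcyl ω₀ m B).trans ?_)
      refine (ENNReal.ofReal_le_ofReal hmain).trans ?_
      rw [ENNReal.ofReal_mul (by positivity), ← ENNReal.ofReal_rpow_of_nonneg (abs_nonneg _) ht.le,
        ← Real.dist_eq, ← edist_dist]
      gcongr
      exact Metric.edist_le_ediam_of_mem hω hω'
  refine le_dimH_of_hausdorffMeasure_ne_zero fun hzero => ?_
  have hK0 : ENNReal.ofReal (C * 4 ^ t) ≠ 0 := by
    have : 0 < C * 4 ^ t := by positivity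
    simpa using this
  have hle : (ENNReal.ofReal (C * 4 ^ t))⁻¹ • OuterMeasure.map f P.toOuterMeasure ≤
      OuterMeasure.mkMetric (fun d => d ^ (s : ℝ)) := by
    refine OuterMeasure.le_mkMetric _ _ 1 one_pos fun U _ => ?_
    rw [smul_apply, OuterMeasure.map_apply, smul_eq_mul, hst,
      ENNReal.inv_mul_le_iff hK0 ENNReal.ofReal_ne_top]
    exact hball U
  have hX1 : f ⁻¹' X = univ := eq_univ_of_forall fun ω =>
    hX (fun m => ω m) (hword ω) _ (hf01 ω) (hfirr ω) (hf ω)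
  have h1 := hle X
  rw [← Measure.mkMetric_toOuterMeasure] at h1
  have h2 : (Measure.mkMetric (fun d => d ^ (s : ℝ)) : Measure ℝ).toOuterMeasure X = 0 := hzero
  rw [h2, smul_apply, OuterMeasure.map_apply, hX1, Measure.toOuterMeasure_apply,
    measure_univ, smul_eq_mul, mul_one] at h1
  simp at h1

end MassDistribution

/-- The word of natural numbers underlying a tuple of positive integers. -/
def pnatWord {n : ℕ} (u : Fin n → ℕ+) : List ℕ := (List.ofFn u).map PNat.val

/-- The sum `∑ qₙ⁻²ˢ` over all words of length `n`. -/
noncomputable def cfSum (n : ℕ) (s : ℝ) : ℝ≥0∞ :=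
  ∑' u : Fin n → ℕ+, ENNReal.ofReal (cfDen (pnatWord u) 0 ^ (-(2 * s)))

theorem one_le_of_mem_pnatWord {n : ℕ} (u : Fin n → ℕ+) : ∀ a ∈ pnatWord u, 1 ≤ a := by
  intro a ha
  obtain ⟨b, -, rfl⟩ := List.mem_map.1 ha
  exact b.2

theorem length_pnatWord {n : ℕ} (u : Fin n → ℕ+) : (pnatWord u).length = n := by
  simp [pnatWord]

theorem pnatWord_injective {n : ℕ} : Function.Injective (pnatWord (n := n)) := fun _ _ h =>
  List.ofFn_injective (List.map_injective_iff.2 PNat.coe_injective h)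

theorem pnatWord_append {m n : ℕ} (u : Fin m → ℕ+) (v : Fin n → ℕ+) :
    pnatWord (Fin.append u v) = pnatWord u ++ pnatWord v := by
  simp [pnatWord, List.ofFn_fin_append]

theorem one_le_cfDen_pnatWord {n : ℕ} (u : Fin n → ℕ+) : 1 ≤ cfDen (pnatWord u) 0 :=
  one_le_cfDen (one_le_of_mem_pnatWord u) (by simp)

theorem cfSum_add_eq (m n : ℕ) (s : ℝ) :
    cfSum (m + n) s = ∑' u : Fin m → ℕ+, ∑' v : Fin n → ℕ+,
      ENNReal.ofReal (cfDen (pnatWord u ++ pnatWord v) 0 ^ (-(2 * s))) := by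
  rw [cfSum, ← (Fin.appendEquiv m n).tsum_eq, ENNReal.tsum_prod']
  simp [Fin.appendEquiv, pnatWord_append]

theorem cfSum_mul_cfSum_eq (m n : ℕ) (s : ℝ) :
    cfSum m s * cfSum n s = ∑' u : Fin m → ℕ+, ∑' v : Fin n → ℕ+,
      ENNReal.ofReal (cfDen (pnatWord u) 0 ^ (-(2 * s)) * cfDen (pnatWord v) 0 ^ (-(2 * s))) := by
  have h : ∀ (u : Fin m → ℕ+), 0 ≤ cfDen (pnatWord u) 0 ^ (-(2 * s)) := fun u =>
    Real.rpow_nonneg (zero_le_one.trans (one_le_cfDen_pnatWord u)) _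
  simp_rw [cfSum, ENNReal.ofReal_mul (h _), ENNReal.tsum_mul_left, ENNReal.tsum_mul_right]

theorem rpow_neg_two_mul_le {x y s : ℝ} (hs : 0 ≤ s) (hx : 0 < x) (h : x ≤ 2 * y) :
    y ^ (-(2 * s)) ≤ 4 ^ s * x ^ (-(2 * s)) := by
  have h4 : (4 : ℝ) ^ s = (2⁻¹) ^ (-(2 * s)) := by
    rw [Real.inv_rpow (by norm_num), Real.rpow_neg (by norm_num), inv_inv,
      Real.rpow_mul (by norm_num)]
    norm_num
  rw [h4, ← Real.mul_rpow (by norm_num) hx.le]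
  exact Real.rpow_le_rpow_of_nonpos (by positivity) (by linarith) (by linarith)

theorem cfSum_add_le {s : ℝ} (hs : 0 ≤ s) (m n : ℕ) :
    cfSum (m + n) s ≤ ENNReal.ofReal (4 ^ s) * (cfSum m s * cfSum n s) := by
  rw [cfSum_add_eq, cfSum_mul_cfSum_eq, ← ENNReal.tsum_mul_left]
  refine ENNReal.tsum_le_tsum fun u => ?_
  rw [← ENNReal.tsum_mul_left]
  refine ENNReal.tsum_le_tsum fun v => ?_
  have hu := one_le_of_mem_pnatWord u
  have hv := one_le_of_mem_pnatWord v
  have hu1 := one_le_cfDen_pnatWord u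
  have hv1 := one_le_cfDen_pnatWord v
  have huv : 1 ≤ cfDen (pnatWord u ++ pnatWord v) 0 := by
    rw [← pnatWord_append]; exact one_le_cfDen_pnatWord _
  rw [← ENNReal.ofReal_mul (by positivity), ← Real.mul_rpow (by linarith) (by linarith)]
  exact ENNReal.ofReal_le_ofReal (rpow_neg_two_mul_le hs (by positivity)
    (le_cfDen_append hu hv))

theorem cfSum_mul_le {s : ℝ} (hs : 0 ≤ s) (m n : ℕ) :
    cfSum m s * cfSum n s ≤ ENNReal.ofReal (4 ^ s) * cfSum (m + n) s := by
  rw [cfSum_add_eq, cfSum_mul_cfSum_eq, ← ENNReal.tsum_mul_left]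
  refine ENNReal.tsum_le_tsum fun u => ?_
  rw [← ENNReal.tsum_mul_left]
  refine ENNReal.tsum_le_tsum fun v => ?_
  have hu := one_le_of_mem_pnatWord u
  have hv := one_le_of_mem_pnatWord v
  have hu1 := one_le_cfDen_pnatWord u
  have hv1 := one_le_cfDen_pnatWord v
  have huv : 1 ≤ cfDen (pnatWord u ++ pnatWord v) 0 := by
    rw [← pnatWord_append]; exact one_le_cfDen_pnatWord _
  rw [← ENNReal.ofReal_mul (by positivity), ← Real.mul_rpow (by linarith) (by linarith)]
  exact ENNReal.ofReal_le_ofReal (rpow_neg_two_mul_le hs (by linarith)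
    (cfDen_append_le hu hv))

theorem cfSum_ne_zero (n : ℕ) (s : ℝ) : cfSum n s ≠ 0 := by
  intro h
  have h1 := ENNReal.tsum_eq_zero.1 h fun _ => 1
  have h2 : 0 < cfDen (pnatWord fun _ : Fin n => (1 : ℕ+)) 0 ^ (-(2 * s)) :=
    Real.rpow_pos_of_pos (zero_lt_one.trans_le (one_le_cfDen_pnatWord _)) _
  exact absurd h1 (by simpa using h2)

theorem cfSum_ne_top_of_le {s : ℝ} (hs : 0 ≤ s) {m n : ℕ} (hmn : m ≤ n) (h : cfSum n s ≠ ∞) :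
    cfSum m s ≠ ∞ := by
  obtain ⟨j, rfl⟩ := Nat.exists_eq_add_of_le hmn
  intro hm
  have h1 := cfSum_mul_le hs m j
  rw [hm, ENNReal.top_mul (cfSum_ne_zero j s), top_le_iff] at h1
  exact ENNReal.mul_ne_top ENNReal.ofReal_ne_top h h1

theorem tsum_ne_top_of_add_le {u : ℕ → ℝ≥0∞} {ρ : ℝ≥0∞} {N : ℕ} (hN : N ≠ 0) (hρ : ρ < 1)
    (hu : ∀ n < N, u n ≠ ∞) (h : ∀ n, u (n + N) ≤ ρ * u n) : ∑' n, u n ≠ ∞ := by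
  have : NeZero N := ⟨hN⟩
  have h1 : ∀ (j : ℕ) (i : Fin N), u (j * N + i) ≤ ρ ^ j * u i := by
    intro j i
    induction j with
    | zero => simp
    | succ j ih =>
      calc u ((j + 1) * N + i) = u (j * N + i + N) := by congr 1; ring
        _ ≤ ρ * (ρ ^ j * u i) := (h _).trans (by gcongr)
        _ = ρ ^ (j + 1) * u i := by ring
  have h2 : ∑' n, u n ≤ ∑' p : ℕ × Fin N, ρ ^ p.1 * u p.2 := by
    rw [← (Nat.divModEquiv N).symm.tsum_eq]
    refine ENNReal.tsum_le_tsum fun p => ?_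
    simpa [Nat.divModEquiv, mul_comm] using h1 p.1 p.2
  refine ne_top_of_le_ne_top ?_ h2
  rw [ENNReal.tsum_prod']
  simp_rw [ENNReal.tsum_mul_left, ENNReal.tsum_mul_right, ENNReal.tsum_geometric]
  refine ENNReal.mul_ne_top ?_ ?_
  · exact ENNReal.inv_ne_top.2 (tsub_pos_of_lt hρ).ne'
  · rw [tsum_fintype]
    exact ENNReal.sum_ne_top.2 fun i _ => hu i i.2

theorem tsum_cfSum_mul_pow_ne_top {s : ℝ} (hs : 0 ≤ s) {c : ℝ≥0∞} (hc : c ≠ ∞) (hc0 : c ≠ 0) {N : ℕ}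
    (hN : N ≠ 0) (h : ENNReal.ofReal (4 ^ s) * cfSum N s * c ^ N < 1) :
    ∑' n, cfSum n s * c ^ n ≠ ∞ := by
  have h4 : ENNReal.ofReal (4 ^ s) ≠ 0 := by
    have : (0 : ℝ) < 4 ^ s := by positivity
    simpa using this
  have hNtop : cfSum N s ≠ ∞ := by
    intro hN
    rw [hN, ENNReal.mul_top h4, ENNReal.top_mul (pow_ne_zero _ hc0)] at h
    exact absurd h (by simp)
  refine tsum_ne_top_of_add_le hN h (fun n hn => ?_) fun n => ?_
  · exact ENNReal.mul_ne_top (cfSum_ne_top_of_le hs hn.le hNtop) (ENNReal.pow_ne_top hc)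
  · calc cfSum (n + N) s * c ^ (n + N)
        ≤ ENNReal.ofReal (4 ^ s) * (cfSum n s * cfSum N s) * c ^ (n + N) := by
          gcongr; exact cfSum_add_le hs n N
      _ = _ := by rw [pow_add]; ring

section GrowthRate

/-- The factor by which the `s`-dimensional covering sum grows per step when the blocks of
the prescribed digits are cut after the first `k` of them. -/
noncomputable def growthRate (A : ℕ → ℝ) (k : ℕ) (s : ℝ) : ℝ :=
  (∏ i ∈ Finset.range k, A i) ^ (1 - 2 * s) * A k ^ (-s)

/-- The tuples `b` with `A i ^ n ≤ b i ≤ 2 * A i ^ n` for all `i < k`. -/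
def digitBox (A : ℕ → ℝ) (k n : ℕ) : Set (Fin k → ℕ+) :=
  {b | ∀ i : Fin k, A i ^ n ≤ ((b i : ℕ) : ℝ) ∧ ((b i : ℕ) : ℝ) ≤ 2 * A i ^ n}

variable {A : ℕ → ℝ} {k n : ℕ}

theorem prod_pos_of_one_lt (hA : ∀ i, 1 < A i) (k : ℕ) : 0 < ∏ i ∈ Finset.range k, A i :=
  Finset.prod_pos fun i _ => zero_lt_one.trans (hA i)

theorem growthRate_pos (hA : ∀ i, 1 < A i) (k : ℕ) (s : ℝ) : 0 < growthRate A k s :=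
  mul_pos (Real.rpow_pos_of_pos (prod_pos_of_one_lt hA k) _)
    (Real.rpow_pos_of_pos (zero_lt_one.trans (hA k)) _)

theorem pow_prod_le_cfDen_of_mem_digitBox {b : Fin k → ℕ+} (hA : ∀ i, 1 < A i)
    (hb : b ∈ digitBox A k n) : (∏ i ∈ Finset.range k, A i) ^ n ≤ cfDen (pnatWord b) 0 := by
  refine le_trans ?_ (prod_le_cfDen (one_le_of_mem_pnatWord b) (by simp))
  rw [pnatWord, List.map_ofFn, List.prod_ofFn, Nat.cast_prod, ← Finset.prod_pow,
    Finset.prod_range]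
  exact Finset.prod_le_prod (fun i _ => (pow_pos (zero_lt_one.trans (hA i)) n).le)
    fun i _ => (hb i).1

theorem tsum_indicator_digitBox_le (hA : ∀ i, 1 < A i) (k n : ℕ) (C : ℝ≥0∞) :
    ∑' b, (digitBox A k n).indicator (fun _ => C) b ≤
      ENNReal.ofReal (2 ^ k * (∏ i ∈ Finset.range k, A i) ^ n) * C := by
  classical
  have hpos : ∀ i, 0 < ⌊2 * A i ^ n⌋₊ := fun i => by
    rw [Nat.floor_pos]
    linarith [one_le_pow₀ (n := n) (hA i).le]
  obtain ⟨f, hf⟩ : ∃ f : ℕ → ℕ+, ∀ i, (f i : ℕ) = ⌊2 * A i ^ n⌋₊ :=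
    ⟨fun i => ⟨_, hpos i⟩, fun _ => rfl⟩
  let F : Finset (Fin k → ℕ+) := Fintype.piFinset fun i => Finset.Icc 1 (f i)
  have hF : ∀ b ∉ F, (digitBox A k n).indicator (fun _ => C) b = 0 := by
    intro b hb
    refine Set.indicator_of_notMem (fun h => hb ?_) _
    refine Fintype.mem_piFinset.2 fun i => Finset.mem_Icc.2 ⟨one_le, ?_⟩
    rw [← PNat.coe_le_coe, hf]
    exact Nat.le_floor (h i).2
  have hcard : (F.card : ℝ) ≤ 2 ^ k * (∏ i ∈ Finset.range k, A i) ^ n := by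
    rw [Fintype.card_piFinset, Nat.cast_prod, Finset.prod_range, ← Finset.prod_pow]
    have : (2 : ℝ) ^ k * ∏ i : Fin k, A i ^ n = ∏ i : Fin k, (2 * A i ^ n) := by
      simp [Finset.prod_mul_distrib]
    rw [this]
    refine Finset.prod_le_prod (fun i _ => by positivity) fun i _ => ?_
    rw [PNat.card_Icc, hf, PNat.one_coe, Nat.add_sub_cancel]
    exact Nat.floor_le (by have := zero_lt_one.trans (hA i); positivity)
  rw [tsum_eq_sum hF]
  calc ∑ b ∈ F, (digitBox A k n).indicator (fun _ => C) b ≤ ∑ _b ∈ F, C :=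
        Finset.sum_le_sum fun b _ => Set.indicator_le_self' (fun _ _ => zero_le) b
    _ = ENNReal.ofReal F.card * C := by simp
    _ ≤ _ := by gcongr

/-- The set of points whose expansion starts with `u b` and continues with a digit at least
`r⁻¹`. -/
noncomputable def cfCylinder {n k : ℕ} (u : Fin n → ℕ+) (b : Fin k → ℕ+) (r : ℝ) : Set ℝ :=
  cfEval (pnatWord u ++ pnatWord b) '' Ioc 0 r

theorem ediam_cfCylinder_le {m : ℕ} {u : Fin m → ℕ+} {b : Fin k → ℕ+} (hA : ∀ i, 1 < A i)
    (hb : b ∈ digitBox A k n) :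
    Metric.ediam (cfCylinder u b (A k ^ n)⁻¹) ≤ ENNReal.ofReal (16 * (A k ^ n)⁻¹ *
      (((∏ i ∈ Finset.range k, A i) ^ n) ^ 2)⁻¹ * (cfDen (pnatWord u) 0 ^ 2)⁻¹) := by
  have hl : ∀ a ∈ pnatWord u ++ pnatWord b, 1 ≤ a := fun a ha =>
    (List.mem_append.1 ha).elim (one_le_of_mem_pnatWord u a) (one_le_of_mem_pnatWord b a)
  have hk : 0 < A k ^ n := pow_pos (zero_lt_one.trans (hA k)) n
  have hk1 : (A k ^ n)⁻¹ ≤ 1 := inv_le_one_of_one_le₀ (one_le_pow₀ (hA k).le)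
  set P := ∏ i ∈ Finset.range k, A i
  have hP : 0 < P ^ n := pow_pos (prod_pos_of_one_lt hA k) n
  have hq := one_le_cfDen_pnatWord u
  set q := cfDen (pnatWord u) 0
  have hQ : q * P ^ n / 2 ≤ cfDen (pnatWord u ++ pnatWord b) 0 := by
    have h1 := le_cfDen_append (one_le_of_mem_pnatWord u) (one_le_of_mem_pnatWord b)
    have h2 := mul_le_mul_of_nonneg_left (pow_prod_le_cfDen_of_mem_digitBox hA hb)
      (zero_le_one.trans hq)
    linarith
  have key : ∀ z ∈ Ioc 0 (A k ^ n)⁻¹, ∀ w ∈ Ioc 0 (A k ^ n)⁻¹,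
      |cfEval (pnatWord u ++ pnatWord b) z - cfEval (pnatWord u ++ pnatWord b) w| ≤
      16 * (A k ^ n)⁻¹ * ((P ^ n) ^ 2)⁻¹ * (q ^ 2)⁻¹ := by
    intro z hz w hw
    refine (abs_cfEval_sub_le hl ⟨hz.1.le, hz.2.trans hk1⟩ ⟨hw.1.le, hw.2.trans hk1⟩).trans ?_
    have hzw : |z - w| ≤ (A k ^ n)⁻¹ :=
      abs_sub_le_iff.2 ⟨by linarith [hz.2, hw.1], by linarith [hw.2, hz.1]⟩
    calc 4 * |z - w| / cfDen (pnatWord u ++ pnatWord b) 0 ^ 2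
        ≤ 4 * (A k ^ n)⁻¹ / (q * P ^ n / 2) ^ 2 := by gcongr
      _ = _ := by field_simp; norm_num
  refine Metric.ediam_le ?_
  rintro _ ⟨z, hz, rfl⟩ _ ⟨w, hw, rfl⟩
  rw [edist_dist, Real.dist_eq]
  exact ENNReal.ofReal_le_ofReal (key z hz w hw)

theorem rpow_mul_eq_growthRate_pow {a P q s : ℝ} (ha : 0 < a) (hP : 0 < P) (hq : 0 < q) (k n : ℕ) :
    2 ^ k * P ^ n * (16 * (a ^ n)⁻¹ * ((P ^ n) ^ 2)⁻¹ * (q ^ 2)⁻¹) ^ s =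
      16 ^ s * 2 ^ k * (P ^ (1 - 2 * s) * a ^ (-s)) ^ n * q ^ (-(2 * s)) := by
  refine Real.log_injOn_pos (Set.mem_Ioi.2 (by positivity)) (Set.mem_Ioi.2 (by positivity)) ?_
  have h1 : Real.log (16 * (a ^ n)⁻¹ * ((P ^ n) ^ 2)⁻¹ * (q ^ 2)⁻¹) =
      Real.log 16 - n * Real.log a - 2 * (n * Real.log P) - 2 * Real.log q := by
    rw [Real.log_mul (by positivity) (by positivity), Real.log_mul (by positivity) (by positivity),
      Real.log_mul (by positivity) (by positivity), Real.log_inv, Real.log_inv, Real.log_inv]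
    simp only [Real.log_pow]; push_cast; ring
  have h2 : Real.log (P ^ (1 - 2 * s) * a ^ (-s)) = (1 - 2 * s) * Real.log P - s * Real.log a := by
    rw [Real.log_mul (by positivity) (by positivity), Real.log_rpow hP, Real.log_rpow ha]; ring
  rw [Real.log_mul (by positivity) (by positivity), Real.log_mul (by positivity) (by positivity),
    Real.log_rpow (by positivity), h1, Real.log_mul (by positivity) (by positivity),
    Real.log_mul (by positivity) (by positivity), Real.log_mul (by positivity) (by positivity),
    Real.log_rpow (by positivity), Real.log_rpow hq, Real.log_pow, Real.log_pow, Real.log_pow, h2]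
  ring

theorem tsum_ediam_cfCylinder_le {s : ℝ} (hA : ∀ i, 1 < A i) (hs : 0 < s) (m : ℕ) :
    ∑' u : Fin m → ℕ+, ∑' b, (digitBox A k (m + 1)).indicator
      (fun b => Metric.ediam (cfCylinder u b (A k ^ (m + 1))⁻¹) ^ s) b ≤
    ENNReal.ofReal (16 ^ s * 2 ^ k * growthRate A k s) *
      (cfSum m s * ENNReal.ofReal (growthRate A k s) ^ m) := by
  have hc := growthRate_pos hA k s
  have hu : ∀ u : Fin m → ℕ+, ∑' b, (digitBox A k (m + 1)).indicator
      (fun b => Metric.ediam (cfCylinder u b (A k ^ (m + 1))⁻¹) ^ s) b ≤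
      ENNReal.ofReal (16 ^ s * 2 ^ k * growthRate A k s) *
        ENNReal.ofReal (growthRate A k s) ^ m *
          ENNReal.ofReal (cfDen (pnatWord u) 0 ^ (-(2 * s))) := by
    intro u
    have hq := one_le_cfDen_pnatWord u
    have hP := prod_pos_of_one_lt hA k
    have hk := zero_lt_one.trans (hA k)
    refine (ENNReal.tsum_le_tsum fun b => ?_).trans ((tsum_indicator_digitBox_le hA k (m + 1)
      (ENNReal.ofReal ((16 * (A k ^ (m + 1))⁻¹ *
        (((∏ i ∈ Finset.range k, A i) ^ (m + 1)) ^ 2)⁻¹ * (cfDen (pnatWord u) 0 ^ 2)⁻¹) ^ s))).trans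
        (le_of_eq ?_))
    · refine Set.indicator_le (fun b hb => ?_) b
      rw [Set.indicator_of_mem hb, ← ENNReal.ofReal_rpow_of_nonneg (by positivity) hs.le]
      exact ENNReal.rpow_le_rpow (ediam_cfCylinder_le hA hb) hs.le
    · rw [← ENNReal.ofReal_mul (by positivity),
        rpow_mul_eq_growthRate_pow hk hP (by linarith), ← growthRate, pow_succ',
        ← ENNReal.ofReal_pow hc.le, ← ENNReal.ofReal_mul (by positivity),
        ← ENNReal.ofReal_mul (by positivity)]
      congr 1; ring
  refine (ENNReal.tsum_le_tsum hu).trans (le_of_eq ?_)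
  rw [ENNReal.tsum_mul_left, ← cfSum]; ring

theorem dimH_le_of_frequently_mem {s : ℝ≥0} (hA : ∀ i, 1 < A i) (hs : 0 < s) {N : ℕ} (hN : N ≠ 0)
    (h : ENNReal.ofReal (4 ^ (s : ℝ)) * cfSum N s * ENNReal.ofReal (growthRate A k s) ^ N < 1)
    {X : Set ℝ} (hX : ∀ x ∈ X, x ∈ Ioo (0 : ℝ) 1 ∧ Irrational x ∧ ∃ᶠ n in atTop, ∀ i ≤ k,
      A i ^ (n + 1) ≤ cfA x (n + 1 + i) ∧ (cfA x (n + 1 + i) : ℝ) ≤ 2 * A i ^ (n + 1)) :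
    dimH X ≤ s := by
  classical
  have hs' : (0 : ℝ) < s := hs
  have hc := growthRate_pos hA k s
  have hsum := tsum_cfSum_mul_pow_ne_top hs'.le ENNReal.ofReal_ne_top
    (ENNReal.ofReal_pos.2 hc).ne' hN h
  have hk := hA k
  let ι : ℕ → Type := fun M => Σ n : ℕ, (Fin (n + M) → ℕ+) × (Fin k → ℕ+)
  let E : ∀ M, ι M → Set ℝ := fun M p =>
    if p.2.2 ∈ digitBox A k (p.1 + M + 1) then
      cfCylinder p.2.1 p.2.2 (A k ^ (p.1 + M + 1))⁻¹ else ∅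
  have hlim : Tendsto (fun M : ℕ => ENNReal.ofReal (16 * (A k ^ (M + 1))⁻¹)) atTop (𝓝 0) := by
    rw [← ENNReal.ofReal_zero]
    refine ENNReal.tendsto_ofReal ?_
    have h1 : Tendsto (fun M : ℕ => (A k ^ (M + 1))⁻¹) atTop (𝓝 0) :=
      ((tendsto_pow_atTop_atTop_of_one_lt hk).comp (tendsto_add_atTop_nat 1)).inv_tendsto_atTop
    simpa using h1.const_mul 16
  have hdiam : ∀ M (p : ι M), Metric.ediam (E M p) ≤ ENNReal.ofReal (16 * (A k ^ (M + 1))⁻¹) := by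
    rintro M ⟨n, u, b⟩
    by_cases hb : b ∈ digitBox A k (n + M + 1)
    · simp only [E, if_pos hb]
      refine (ediam_cfCylinder_le hA hb).trans (ENNReal.ofReal_le_ofReal ?_)
      have hP : 1 ≤ ∏ i ∈ Finset.range k, A i := by
        rw [← Finset.prod_const_one]
        exact Finset.prod_le_prod (fun _ _ => zero_le_one) fun i _ => (hA i).le
      have hq := one_le_cfDen_pnatWord u
      have h1 : (((∏ i ∈ Finset.range k, A i) ^ (n + M + 1)) ^ 2)⁻¹ ≤ 1 :=
        inv_le_one_of_one_le₀ (one_le_pow₀ (one_le_pow₀ hP))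
      have h2 : (cfDen (pnatWord u) 0 ^ 2)⁻¹ ≤ 1 := inv_le_one_of_one_le₀ (one_le_pow₀ hq)
      have h3 : (A k ^ (n + M + 1))⁻¹ ≤ (A k ^ (M + 1))⁻¹ :=
        inv_anti₀ (by positivity) (pow_le_pow_right₀ hk.le (by omega))
      have h0 : 0 < (A k ^ (n + M + 1))⁻¹ := by positivity
      calc _ ≤ 16 * (A k ^ (n + M + 1))⁻¹ * 1 * 1 := by gcongr
        _ ≤ _ := by linarith
    · simp [E, if_neg hb]
  have hcover : ∀ M, X ⊆ ⋃ p, E M p := by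
    intro M x hx
    obtain ⟨hx01, hirr, hfreq⟩ := hX x hx
    obtain ⟨m, hm, hd⟩ := frequently_atTop.1 hfreq M
    obtain ⟨n, rfl⟩ := Nat.exists_eq_add_of_le' hm
    let u : Fin (n + M) → ℕ+ := fun i => ⟨cfA x (i + 1), one_le_cfA hx01 hirr i⟩
    let b : Fin k → ℕ+ := fun i => ⟨cfA x (n + M + i + 1), one_le_cfA hx01 hirr _⟩
    have hb : b ∈ digitBox A k (n + M + 1) := by
      intro i
      have := hd i i.2.le
      rw [show n + M + 1 + (i : ℕ) = n + M + i + 1 by ring] at this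
      exact this
    refine mem_iUnion.2 ⟨⟨n, u, b⟩, ?_⟩
    simp only [E, if_pos hb]
    have hT := irrational_gaussMap_iterate hx01 hirr (n + M + k)
    refine ⟨gaussMap^[n + M + k] x, ⟨hT.1.1, ?_⟩, ?_⟩
    · rw [cfA_add_gaussMap_iterate hx01 hirr]
      have h1 := (hd k le_rfl).1
      rw [show n + M + 1 + k = n + M + k + 1 by ring] at h1
      have h2 := (irrational_gaussMap_iterate hx01 hirr (n + M + k + 1)).1.1
      exact inv_anti₀ (by positivity) (by linarith)
    · rw [cfEval_append]
      have h1 := eq_cfEval_ofFn hx01 hirr 0 (n + M)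
      have h2 := eq_cfEval_ofFn hx01 hirr (n + M) k
      simp only [Function.iterate_zero, id, zero_add] at h1
      conv_rhs => rw [h1, h2]
      rw [pnatWord, pnatWord, List.map_ofFn, List.map_ofFn]
      rfl
  have hle := Measure.hausdorffMeasure_le_liminf_tsum (s : ℝ) X _ hlim E
    (Eventually.of_forall hdiam) (Eventually.of_forall hcover)
  have hsumE : ∀ M, ∑' p, Metric.ediam (E M p) ^ (s : ℝ) ≤
      ENNReal.ofReal (16 ^ (s : ℝ) * 2 ^ k * growthRate A k s) *
        ∑' n, cfSum (n + M) s * ENNReal.ofReal (growthRate A k s) ^ (n + M) := by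
    intro M
    rw [ENNReal.tsum_sigma', ← ENNReal.tsum_mul_left]
    refine ENNReal.tsum_le_tsum fun n => ?_
    rw [ENNReal.tsum_prod']
    refine le_trans (le_of_eq ?_) (tsum_ediam_cfCylinder_le hA hs' (n + M))
    refine tsum_congr fun u => tsum_congr fun b => ?_
    by_cases hb : b ∈ digitBox A k (n + M + 1)
    · simp [E, hb]
    · simp [E, hb, hs]
  have htend : Tendsto (fun M => ENNReal.ofReal (16 ^ (s : ℝ) * 2 ^ k * growthRate A k s) *
      ∑' n, cfSum (n + M) s * ENNReal.ofReal (growthRate A k s) ^ (n + M)) atTop (𝓝 0) := by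
    have := ENNReal.Tendsto.const_mul (ENNReal.tendsto_sum_nat_add _ hsum)
      (Or.inr (ENNReal.ofReal_ne_top (r := 16 ^ (s : ℝ) * 2 ^ k * growthRate A k s)))
    simpa using this
  refine dimH_le_of_hausdorffMeasure_ne_top (ne_top_of_le_ne_top ENNReal.zero_ne_top ?_)
  refine hle.trans ?_
  rw [← htend.liminf_eq]
  exact liminf_le_liminf (Eventually.of_forall hsumE)

end GrowthRate

/-- The primes in the interval `[x, 2x]`. -/
noncomputable def primesBetween (x : ℝ) : Finset ℕ :=
  {p ∈ Finset.range (⌊2 * x⌋₊ + 1) | p.Prime ∧ x ≤ p}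

theorem mem_primesBetween {x : ℝ} {p : ℕ} (hx : 0 ≤ x) :
    p ∈ primesBetween x ↔ p.Prime ∧ x ≤ p ∧ (p : ℝ) ≤ 2 * x := by
  rw [primesBetween, Finset.mem_filter, Finset.mem_range, Nat.lt_succ_iff,
    Nat.le_floor_iff (by positivity)]
  tauto

theorem centralBinom_le_mul_pow_card (n : ℕ) (hn : 2 < n) :
    n.centralBinom ≤ (2 * n) ^ Nat.sqrt (2 * n) * 4 ^ (2 * n / 3) *
      (2 * n) ^ {p ∈ Finset.range (2 * n + 1) | p.Prime ∧ n < p}.card := by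
  set R := Finset.range (2 * n + 1)
  have key : ∀ p ∈ R, p ^ n.centralBinom.factorization p ≤
      (if 1 ≤ p ∧ p ≤ Nat.sqrt (2 * n) then 2 * n else 1) *
      (if p.Prime ∧ p ≤ 2 * n / 3 then p else 1) * (if p.Prime ∧ n < p then 2 * n else 1) := by
    intro p _
    have h1 : 1 ≤ if 1 ≤ p ∧ p ≤ Nat.sqrt (2 * n) then 2 * n else 1 := by split_ifs <;> omega
    have h2 : 1 ≤ if p.Prime ∧ p ≤ 2 * n / 3 then p else 1 := by
      split_ifs with h
      · exact h.1.one_lt.le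
      · exact le_rfl
    have h3 : 1 ≤ if p.Prime ∧ n < p then 2 * n else 1 := by split_ifs <;> omega
    have hle : p ^ n.centralBinom.factorization p ≤ 2 * n :=
      Nat.pow_factorization_choose_le (by omega)
    by_cases hp : p.Prime
    · by_cases ha : p ≤ Nat.sqrt (2 * n)
      · rw [if_pos ⟨hp.one_lt.le, ha⟩]
        rw [mul_assoc]
        exact hle.trans (Nat.le_mul_of_pos_right _ (Nat.mul_pos h2 h3))
      by_cases hb : p ≤ 2 * n / 3
      · have : p ^ n.centralBinom.factorization p ≤ p := by
          refine (pow_right_mono₀ hp.one_lt.le ?_).trans (pow_one p).le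
          exact Nat.factorization_choose_le_one (Nat.sqrt_lt'.mp <| not_le.1 ha)
        rw [if_pos (⟨hp, hb⟩ : p.Prime ∧ p ≤ 2 * n / 3)]
        calc _ ≤ 1 * p * 1 := by simpa using this
          _ ≤ _ := Nat.mul_le_mul (Nat.mul_le_mul h1 le_rfl) h3
      by_cases hc : p ≤ n
      · rw [Nat.factorization_centralBinom_of_two_mul_self_lt_three_mul hn hc (by omega), pow_zero]
        exact Nat.mul_pos (Nat.mul_pos h1 h2) h3
      · rw [if_pos (⟨hp, not_le.1 hc⟩ : p.Prime ∧ n < p)]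
        exact hle.trans (Nat.le_mul_of_pos_left _ (Nat.mul_pos h1 h2))
    · rw [Nat.factorization_eq_zero_of_not_prime _ hp, pow_zero]
      exact Nat.mul_pos (Nat.mul_pos h1 h2) h3
  rw [← n.prod_pow_factorization_centralBinom]
  refine (Finset.prod_le_prod' key).trans ?_
  rw [Finset.prod_mul_distrib, Finset.prod_mul_distrib]
  refine Nat.mul_le_mul (Nat.mul_le_mul ?_ ?_) ?_
  · rw [← Finset.prod_filter, Finset.prod_const]
    refine Nat.pow_le_pow_right (by omega) ?_
    refine (Finset.card_le_card (t := Finset.Icc 1 (Nat.sqrt (2 * n))) fun p hp => ?_).trans ?_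
    · exact Finset.mem_Icc.2 (Finset.mem_filter.1 hp).2
    · simp
  · rw [← Finset.prod_filter]
    refine le_trans ?_ (primorial_le_four_pow (2 * n / 3))
    refine Finset.prod_le_prod_of_subset_of_one_le' (fun p hp => ?_) fun p hp _ =>
      (Finset.mem_filter.1 hp).2.one_lt.le
    have := (Finset.mem_filter.1 hp).2
    exact Finset.mem_filter.2 ⟨Finset.mem_range.2 (by omega), this.1⟩
  · rw [← Finset.prod_filter, Finset.prod_const]

theorem mul_log_le_of_card_primes {x : ℝ} (hx : 4 ≤ x) :
    (x - 1) / 3 * Real.log 4 ≤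
      ((primesBetween x).card + √(2 * x) + 1) * Real.log (2 * x) := by
  set n := ⌊x⌋₊
  have hn : 4 ≤ n := Nat.le_floor (by exact_mod_cast hx)
  have hnx : (n : ℝ) ≤ x := Nat.floor_le (by linarith)
  have hxn : x < n + 1 := Nat.lt_floor_add_one x
  have hn' : (4 : ℝ) ≤ n := by exact_mod_cast hn
  set c := {p ∈ Finset.range (2 * n + 1) | p.Prime ∧ n < p}.card
  have hc : c ≤ (primesBetween x).card := by
    refine Finset.card_le_card fun p hp => ?_
    obtain ⟨h1, h2, h3⟩ := Finset.mem_filter.1 hp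
    rw [Finset.mem_range, Nat.lt_succ_iff] at h1
    refine (mem_primesBetween (by linarith)).2 ⟨h2, ?_, ?_⟩
    · have : ((n + 1 : ℕ) : ℝ) ≤ p := by exact_mod_cast h3
      push_cast at this; linarith
    · have : (p : ℝ) ≤ (2 * n : ℕ) := by exact_mod_cast h1
      push_cast at this; linarith
  have h4 : 4 ^ n ≤ n * ((2 * n) ^ Nat.sqrt (2 * n) * 4 ^ (2 * n / 3) * (2 * n) ^ c) :=
    (Nat.four_pow_lt_mul_centralBinom n hn).le.trans
      (Nat.mul_le_mul le_rfl (centralBinom_le_mul_pow_card n (by omega)))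
  have h5 : (4 : ℝ) ^ n ≤ n * ((2 * n) ^ Nat.sqrt (2 * n) * 4 ^ (2 * n / 3) * (2 * n) ^ c) := by
    exact_mod_cast h4
  have h6 := Real.log_le_log (by positivity) h5
  rw [Real.log_mul (by positivity) (by positivity), Real.log_mul (by positivity) (by positivity),
    Real.log_mul (by positivity) (by positivity)] at h6
  simp only [Real.log_pow] at h6
  have hl2n : Real.log (2 * n) ≤ Real.log (2 * x) := Real.log_le_log (by positivity) (by linarith)
  have hln : Real.log n ≤ Real.log (2 * x) := Real.log_le_log (by positivity) (by linarith)
  have hl0 : 0 ≤ Real.log (2 * n) := Real.log_nonneg (by linarith)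
  have hsq : (Nat.sqrt (2 * n) : ℝ) ≤ √(2 * x) :=
    Real.nat_sqrt_le_real_sqrt.trans (Real.sqrt_le_sqrt (by push_cast; linarith))
  have hdiv : ((2 * n / 3 : ℕ) : ℝ) ≤ 2 * n / 3 := by
    refine Nat.cast_div_le.trans ?_
    push_cast; exact le_rfl
  have hl4 : 0 ≤ Real.log 4 := Real.log_nonneg (by norm_num)
  have hc' : (c : ℝ) ≤ (primesBetween x).card := by exact_mod_cast hc
  have e1 := mul_le_mul hsq hl2n hl0 (Real.sqrt_nonneg _)
  have e2 := mul_le_mul hc' hl2n hl0 (Nat.cast_nonneg _)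
  have e3 := mul_le_mul_of_nonneg_right hdiv hl4
  have e4 : (x - 1) / 3 * Real.log 4 ≤ n / 3 * Real.log 4 := by gcongr; linarith
  linarith

theorem eventually_rpow_le_card_primesBetween {ε : ℝ} (hε : 0 < ε) :
    ∀ᶠ x : ℝ in atTop, x ^ (1 - ε) ≤ (primesBetween x).card := by
  set η := min ε (1 / 2)
  have hη : 0 < η := lt_min hε (by norm_num)
  have hη1 : η ≤ ε := min_le_left _ _
  have hη2 : η ≤ 1 / 2 := min_le_right _ _
  have hlog := (isLittleO_log_rpow_atTop hη).bound (show (0 : ℝ) < 1 / 48 by norm_num)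
  filter_upwards [hlog, eventually_ge_atTop 100] with x hlx hx
  have hx0 : 0 < x := by linarith
  rw [Real.norm_eq_abs, Real.norm_eq_abs, abs_of_nonneg (Real.log_nonneg (by linarith)),
    abs_of_nonneg (Real.rpow_nonneg hx0.le _)] at hlx
  by_contra! hlt
  have h := mul_log_le_of_card_primes (x := x) (by linarith)
  have hy1 : x ^ (1 - ε) ≤ x ^ (1 - η) :=
    Real.rpow_le_rpow_of_exponent_le (by linarith) (by linarith)
  have hy2 : √x ≤ x ^ (1 - η) := by
    rw [Real.sqrt_eq_rpow]
    exact Real.rpow_le_rpow_of_exponent_le (by linarith) (by linarith)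
  have hy3 : 1 ≤ x ^ (1 - η) := Real.one_le_rpow (by linarith) (by linarith)
  have hs2 : √(2 * x) ≤ 2 * √x := by
    rw [Real.sqrt_mul (by norm_num)]
    have : √2 ≤ 2 := Real.sqrt_le_iff.2 (by norm_num)
    gcongr
  have hl2 : Real.log (2 * x) ≤ 2 * Real.log x := by
    rw [← Real.log_rpow hx0, Real.rpow_two]
    exact Real.log_le_log (by positivity) (by nlinarith)
  have hl0 : 0 ≤ Real.log (2 * x) := Real.log_nonneg (by linarith)
  have hl4 : 1 ≤ Real.log 4 := by
    rw [Real.le_log_iff_exp_le (by norm_num)]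
    linarith [Real.exp_one_lt_d9]
  have hmul : x ^ (1 - η) * x ^ η = x := by
    rw [← Real.rpow_add hx0]; simp
  have h1 : ((primesBetween x).card + √(2 * x) + 1) * Real.log (2 * x) ≤
      4 * x ^ (1 - η) * (2 * (1 / 48 * x ^ η)) := by
    refine mul_le_mul (by linarith) (by linarith) hl0 (by positivity)
  have h2 : 4 * x ^ (1 - η) * (2 * (1 / 48 * x ^ η)) = x / 6 := by
    rw [show 4 * x ^ (1 - η) * (2 * (1 / 48 * x ^ η)) = 1 / 6 * (x ^ (1 - η) * x ^ η) by ring,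
      hmul]; ring
  have h3 : (x - 1) / 3 ≤ (x - 1) / 3 * Real.log 4 := le_mul_of_one_le_right (by linarith) hl4
  linarith

theorem exists_pos_le_abs_cfEval_sub {v v' : List ℕ} (hv : ∀ a ∈ v, 1 ≤ a) (hv' : ∀ a ∈ v', 1 ≤ a)
    (hlen : v.length = v'.length) (hne : v ≠ v') :
    ∃ δ > 0, ∀ z ∈ Icc (0 : ℝ) 1, ∀ z' ∈ Icc (0 : ℝ) 1,
      δ ≤ |cfEval (v ++ [1]) z - cfEval (v' ++ [1]) z'| := by
  have h1 : ∀ a ∈ [1], 1 ≤ a := by simp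
  have hv1 : ∀ a ∈ v ++ [1], 1 ≤ a := fun a ha => (List.mem_append.1 ha).elim (hv a) (h1 a)
  have hv1' : ∀ a ∈ v' ++ [1], 1 ≤ a := fun a ha => (List.mem_append.1 ha).elim (hv' a) (h1 a)
  have hcont : ContinuousOn
      (fun p : ℝ × ℝ => |cfEval (v ++ [1]) p.1 - cfEval (v' ++ [1]) p.2|)
      (Icc (0 : ℝ) 1 ×ˢ Icc (0 : ℝ) 1) :=
    (((continuousOn_cfEval hv1).comp continuousOn_fst fun _ hp => hp.1).sub
      ((continuousOn_cfEval hv1').comp continuousOn_snd fun _ hp => hp.2)).abs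
  obtain ⟨p, hp, hmin⟩ := (isCompact_Icc.prod isCompact_Icc).exists_isMinOn
    ⟨((0 : ℝ), (0 : ℝ)), by simp⟩ hcont
  refine ⟨_, abs_pos.2 (sub_ne_zero.2 fun h => hne ?_),
    fun z hz z' hz' => hmin (mk_mem_prod hz hz')⟩
  rw [cfEval_append, cfEval_append] at h
  exact eq_of_cfEval_eq hv hv' hlen (cfEval_mem_Ioc_of_ne_nil h1 (by simp) hp.1)
    (cfEval_mem_Ioc_of_ne_nil h1 (by simp) hp.2) h

theorem exists_finset_lt_sum_cfDen {N : ℕ} {t y : ℝ} (hy : 0 ≤ y)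
    (h : ENNReal.ofReal y < cfSum N t) :
    ∃ F : Finset (Fin N → ℕ+), y < ∑ u ∈ F, cfDen (pnatWord u) 0 ^ (-(2 * t)) := by
  rw [cfSum, ENNReal.tsum_eq_iSup_sum] at h
  obtain ⟨F, hF⟩ := lt_iSup_iff.1 h
  refine ⟨F, ?_⟩
  rw [← ENNReal.ofReal_sum_of_nonneg fun u _ =>
    Real.rpow_nonneg (zero_le_one.trans (one_le_cfDen_pnatWord u)) _] at hF
  exact (ENNReal.ofReal_lt_ofReal_iff_of_nonneg hy).1 hF

theorem exists_separated_words {t lam γ₀ : ℝ} (ht : 0 < t) (ht1 : t ≤ 1) (hlam : 1 < lam)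
    (hγ₀ : 0 < γ₀)
    (h : ∀ N ≠ 0, ENNReal.ofReal (lam ^ N) ≤ 4 * cfSum N t * ENNReal.ofReal (γ₀ ^ N)) :
    ∃ L ≠ 0, ∃ W : Finset (List ℕ), (∀ v ∈ W, v.length = L ∧ ∀ a ∈ v, 1 ≤ a) ∧
      4 ^ t ≤ (γ₀ / √lam) ^ L * ∑ v ∈ W, cfDen v 0 ^ (-(2 * t)) ∧
      ∃ δ > 0, ∀ v ∈ W, ∀ v' ∈ W, v ≠ v' → ∀ z ∈ Icc (0 : ℝ) 1, ∀ z' ∈ Icc (0 : ℝ) 1,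
        δ ≤ |cfEval v z - cfEval v' z'| := by
  set μ := √lam
  have hμ : 1 < μ := Real.lt_sqrt_of_sq_lt (by linarith)
  have hμ2 : μ * μ = lam := Real.mul_self_sqrt (by linarith)
  set γ := γ₀ / μ
  have hγ : 0 < γ := by positivity
  have hγ₀' : γ₀ = γ * μ := by simp only [γ]; field_simp
  obtain ⟨N, hN, hN0⟩ := ((tendsto_pow_atTop_atTop_of_one_lt hμ).eventually_gt_atTop
    (64 / γ)).and (eventually_ne_atTop 0) |>.exists
  have hlt : ENNReal.ofReal (16 / γ ^ (N + 1)) < cfSum N t := by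
    by_contra! hle
    have h1 : ENNReal.ofReal (lam ^ N) ≤
        ENNReal.ofReal (4 * (16 / γ ^ (N + 1)) * γ₀ ^ N) := by
      rw [ENNReal.ofReal_mul (by positivity), ENNReal.ofReal_mul (by norm_num),
        ENNReal.ofReal_ofNat]
      exact (h N hN0).trans (by gcongr)
    rw [ENNReal.ofReal_le_ofReal_iff (by positivity), ← hμ2, hγ₀', mul_pow, mul_pow] at h1
    have h2 : 4 * (16 / γ ^ (N + 1)) * (γ ^ N * μ ^ N) = 64 / γ * μ ^ N := by
      field_simp; ring
    rw [h2] at h1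
    exact absurd (le_of_mul_le_mul_right h1 (by positivity)) (not_le.2 hN)
  obtain ⟨F, hF⟩ := exists_finset_lt_sum_cfDen (by positivity) hlt
  have hinj : Function.Injective fun u : Fin N → ℕ+ => pnatWord u ++ [1] := fun u v huv =>
    pnatWord_injective (List.append_left_injective [1] huv)
  have hone : ∀ u : Fin N → ℕ+, ∀ a ∈ pnatWord u ++ [1], 1 ≤ a := fun u a ha =>
    (List.mem_append.1 ha).elim (one_le_of_mem_pnatWord u a) (by simp +contextual)
  refine ⟨N + 1, by omega, F.map ⟨_, hinj⟩, ?_, ?_, ?_⟩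
  · intro v hv
    obtain ⟨u, -, rfl⟩ := Finset.mem_map.1 hv
    exact ⟨by simp [length_pnatWord], hone u⟩
  · rw [Finset.sum_map]
    have hterm : ∀ u ∈ F, cfDen (pnatWord u) 0 ^ (-(2 * t)) ≤
        4 ^ t * cfDen (pnatWord u ++ [1]) 0 ^ (-(2 * t)) := by
      intro u _
      refine rpow_neg_two_mul_le ht.le (zero_lt_one.trans_le (one_le_cfDen (hone u) (by simp))) ?_
      have := cfDen_append_le (one_le_of_mem_pnatWord u) (l' := [1]) (by simp)
      simpa [cfDen, cfEval] using this
    have hsum := hF.le.trans (Finset.sum_le_sum hterm)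
    rw [← Finset.mul_sum] at hsum
    have h4 : (4 : ℝ) ^ t * 4 ^ t ≤ 16 := by
      have : (4 : ℝ) ^ t ≤ 4 := by
        simpa using Real.rpow_le_rpow_of_exponent_le (show (1 : ℝ) ≤ 4 by norm_num) ht1
      nlinarith [show (0 : ℝ) < 4 ^ t by positivity]
    have h5 : (4 : ℝ) ^ t * (4 ^ t / γ ^ (N + 1)) ≤
        4 ^ t * ∑ u ∈ F, cfDen (pnatWord u ++ [1]) 0 ^ (-(2 * t)) := by
      refine le_trans ?_ hsum
      rw [← mul_div_assoc]
      gcongr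
    have h6 := le_of_mul_le_mul_left h5 (by positivity)
    rw [div_le_iff₀ (by positivity)] at h6
    rw [mul_comm]
    exact h6
  · have hev : ∀ᶠ δ : ℝ in 𝓝[>] 0, ∀ p ∈ F ×ˢ F, p.1 ≠ p.2 → ∀ z ∈ Icc (0 : ℝ) 1,
        ∀ z' ∈ Icc (0 : ℝ) 1,
          δ ≤ |cfEval (pnatWord p.1 ++ [1]) z - cfEval (pnatWord p.2 ++ [1]) z'| := by
      rw [Filter.eventually_all_finset]
      intro p _
      by_cases hp : p.1 = p.2
      · exact Eventually.of_forall fun _ h => absurd hp h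
      obtain ⟨δ₀, hδ₀, hsep⟩ := exists_pos_le_abs_cfEval_sub (one_le_of_mem_pnatWord p.1)
        (one_le_of_mem_pnatWord p.2) (by simp [length_pnatWord]) (pnatWord_injective.ne hp)
      filter_upwards [Ioo_mem_nhdsGT hδ₀] with δ hδ _ z hz z' hz'
      exact hδ.2.le.trans (hsep z hz z' hz')
    obtain ⟨δ, hδ, hδ0⟩ := (hev.and self_mem_nhdsWithin).exists
    refine ⟨δ, hδ0, ?_⟩
    intro v hv v' hv' hne
    obtain ⟨u, hu, rfl⟩ := Finset.mem_map.1 hv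
    obtain ⟨u', hu', rfl⟩ := Finset.mem_map.1 hv'
    exact hδ (u, u') (Finset.mem_product.2 ⟨hu, hu'⟩) fun h => hne (by simp only at h; rw [h])

/-- The index `n` is large enough for the primes in `[A k ^ n, 2 * A k ^ n]` to be plentiful. -/
def GoodIndex (A : ℕ → ℝ) (l : ℕ) (t ε : ℝ) (n : ℕ) : Prop :=
  ∀ k < l, 2 < A k ^ n ∧ (A k ^ n) ^ (1 - ε) ≤ (primesBetween (A k ^ n)).card ∧
    16 * (A k ^ n) ^ (t - 1) ≤ 1

theorem eventually_goodIndex {A : ℕ → ℝ} (hA : ∀ i, 1 < A i) (l : ℕ) {t ε : ℝ} (ht : t < 1)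
    (hε : 0 < ε) : ∀ᶠ n in atTop, GoodIndex A l t ε n := by
  have h : ∀ k, ∀ᶠ n in atTop, k < l → 2 < A k ^ n ∧
      (A k ^ n) ^ (1 - ε) ≤ (primesBetween (A k ^ n)).card ∧ 16 * (A k ^ n) ^ (t - 1) ≤ 1 := by
    intro k
    have h1 : ∀ᶠ x : ℝ in atTop, x ^ (t - 1) ≤ 1 / 16 := by
      have := tendsto_rpow_neg_atTop (y := 1 - t) (by linarith)
      simp only [neg_sub] at this
      exact this.eventually_le_const (by norm_num)
    filter_upwards [(tendsto_pow_atTop_atTop_of_one_lt (hA k)).eventually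
      ((eventually_gt_atTop 2).and ((eventually_rpow_le_card_primesBetween hε).and h1))] with n hn _
    exact ⟨hn.1, hn.2.1, by linarith [hn.2.2]⟩
  have := (Finset.range l).eventually_all.2 fun k _ => h k
  filter_upwards [this] with n hn k hk
  exact hn k (Finset.mem_range.2 hk) hk

theorem exists_free_count {A : ℕ → ℝ} (hA : ∀ i, 1 < A i) (l : ℕ) {t ε γ θ : ℝ} (ht : t < 1)
    (hε : 0 < ε) (hγ : 0 < γ) (hθ : 0 ≤ θ) {L : ℕ} (hL : L ≠ 0) (hθγ : θ ≤ γ ^ L)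
    (hρ : ∀ k < l, γ * A k ^ (t + ε) * (∏ i ∈ Finset.range k, A i) ^ (2 * t - 1 + ε) < 1) (E : ℕ) :
    ∃ f, GoodIndex A l t ε (E + L * f + 1) ∧ ∀ k < l,
      θ ^ f * ∏ i ∈ Finset.range k, (16 * (A i ^ (E + L * f + 1)) ^ (2 * t - 1 + ε)) ≤
        (A k ^ (E + L * f + 1)) ^ (-(t + ε)) := by
  have h : ∀ k, ∀ᶠ n : ℕ in atTop, k < l → 16 ^ k *
      (γ * A k ^ (t + ε) * (∏ i ∈ Finset.range k, A i) ^ (2 * t - 1 + ε)) ^ n ≤ γ ^ (E + 1) := by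
    intro k
    by_cases hk : k < l
    · have hk0 := zero_lt_one.trans (hA k)
      have hP := prod_pos_of_one_lt hA k
      have := (tendsto_pow_atTop_nhds_zero_of_lt_one (by positivity) (hρ k hk)).const_mul
        ((16 : ℝ) ^ k)
      rw [mul_zero] at this
      filter_upwards [this.eventually_le_const (pow_pos hγ (E + 1))] with n hn _
      exact hn
    · exact Eventually.of_forall fun _ h => absurd h hk
  have h' := (eventually_goodIndex hA l ht hε).and
    ((Finset.range l).eventually_all.2 fun k _ => h k)
  have htend : Tendsto (fun f => E + L * f + 1) atTop atTop :=
    tendsto_atTop_mono (fun f => by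
      have := Nat.le_mul_of_pos_left f (Nat.pos_of_ne_zero hL)
      show f ≤ E + L * f + 1
      omega) tendsto_id
  obtain ⟨f, hgood, hf⟩ := (htend.eventually h').exists
  refine ⟨f, hgood, fun k hk => ?_⟩
  have hfk := hf k (Finset.mem_range.2 hk) hk
  set n := E + L * f + 1 with hn
  set P := ∏ i ∈ Finset.range k, A i with hPdef
  have hk0 : 0 < A k := zero_lt_one.trans (hA k)
  have hP : 0 < P := prod_pos_of_one_lt hA k
  have hprod : ∏ i ∈ Finset.range k, (16 * (A i ^ n) ^ (2 * t - 1 + ε)) =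
      16 ^ k * (P ^ (2 * t - 1 + ε)) ^ n := by
    rw [Finset.prod_mul_distrib, Finset.prod_const, Finset.card_range, Real.finsetProd_rpow _ _
      fun i _ => (pow_pos (zero_lt_one.trans (hA i)) n).le, Finset.prod_pow,
      Real.rpow_pow_comm hP.le]
  rw [hprod, Real.rpow_neg (by positivity), ← Real.rpow_pow_comm hk0.le, ← one_div,
    le_div_iff₀ (by positivity)]
  have hθf : θ ^ f ≤ γ ^ (L * f) := by rw [pow_mul]; gcongr
  have hγE : 0 < γ ^ (E + 1) := by positivity
  refine le_of_mul_le_mul_left ?_ hγE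
  calc γ ^ (E + 1) * (θ ^ f * (16 ^ k * (P ^ (2 * t - 1 + ε)) ^ n) * (A k ^ (t + ε)) ^ n)
      ≤ γ ^ (E + 1) * (γ ^ (L * f) * (16 ^ k * (P ^ (2 * t - 1 + ε)) ^ n) *
        (A k ^ (t + ε)) ^ n) := by gcongr
    _ = 16 ^ k * (γ * A k ^ (t + ε) * P ^ (2 * t - 1 + ε)) ^ n := by
      rw [mul_pow, mul_pow, hn, show E + L * f + 1 = (E + 1) + L * f by ring, pow_add γ]; ring
    _ ≤ γ ^ (E + 1) * 1 := by rw [mul_one]; exact hfk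

theorem exists_prime_words_separated {x r t ε : ℝ} (hx : 2 < x) (ht : 0 < t) (ht1 : t < 1)
    (hr : r ≤ x ^ (-(t + ε))) (hcard : x ^ (1 - ε) ≤ (primesBetween x).card)
    {B : Finset (List ℕ)} (hB : B ⊆ (primesBetween x).image fun p => [p]) (hnt : B.Nontrivial) :
    ∃ v ∈ B, ∃ v' ∈ B, ∀ z ∈ Icc (0 : ℝ) 1, ∀ z' ∈ Icc (0 : ℝ) 1,
      r * ∑ _u ∈ B, ((primesBetween x).card : ℝ)⁻¹ ≤ 36 * |cfEval v z - cfEval v' z'| ^ t := by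
  classical
  have hx0 : 0 < x := by linarith
  have hinj : Function.Injective fun p : ℕ => [p] := fun p q h => by simpa using h
  obtain ⟨S, hS, rfl⟩ := Finset.subset_image_iff.1 hB
  have hSprime : ∀ p ∈ S, p.Prime ∧ x ≤ p ∧ (p : ℝ) ≤ 2 * x := fun p hp =>
    (mem_primesBetween hx0.le).1 (hS hp)
  have hSnt : S.Nontrivial := by
    rw [← Finset.one_lt_card_iff_nontrivial] at hnt ⊢
    rwa [Finset.card_image_of_injective _ hinj] at hnt
  have hne := hSnt.nonempty
  set p := S.min' hne
  set q := S.max' hne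
  have hp := S.min'_mem hne
  have hq := S.max'_mem hne
  have hpq : p < q := Finset.min'_lt_max'_of_card S (Finset.one_lt_card_iff_nontrivial.2 hSnt)
  obtain ⟨hpp, hp1, hp2⟩ := hSprime p hp
  obtain ⟨hqp, hq1, hq2⟩ := hSprime q hq
  have hpq2 : p + 2 ≤ q := by
    have h2p : 2 < p := by exact_mod_cast hx.trans_le hp1
    have h1 := (hpp.eq_two_or_odd).resolve_left h2p.ne'
    have h2 := (hqp.eq_two_or_odd).resolve_left (h2p.trans hpq).ne'
    omega
  have hcardS : (S.card : ℝ) ≤ 2 * ((q : ℝ) - p) := by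
    have h1 : S.card ≤ q + 1 - p := by
      rw [← Nat.card_Icc]
      exact Finset.card_le_card fun a ha => Finset.mem_Icc.2 ⟨S.min'_le a ha, S.le_max' a ha⟩
    have h2 : ((S.card + p : ℕ) : ℝ) ≤ (q + 1 : ℕ) := by exact_mod_cast (by omega)
    have h3 : ((p + 2 : ℕ) : ℝ) ≤ q := by exact_mod_cast hpq2
    push_cast at h2 h3
    linarith
  have hD2 : (2 : ℝ) ≤ q - p := by
    have h3 : ((p + 2 : ℕ) : ℝ) ≤ q := by exact_mod_cast hpq2
    push_cast at h3; linarith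
  set D : ℝ := q - p
  have hDx : D ≤ x := by simp only [D]; linarith
  refine ⟨[p], Finset.mem_image_of_mem _ hp, [q], Finset.mem_image_of_mem _ hq, ?_⟩
  intro z hz z' hz'
  have hdist : D / (18 * x ^ 2) ≤ |cfEval [p] z - cfEval [q] z'| := by
    have e1 : 0 < (p : ℝ) + z := by linarith [hz.1]
    have e2 : 0 < (q : ℝ) + z' := by linarith [hz'.1]
    have e3 : cfEval [p] z - cfEval [q] z' = ((q + z') - (p + z)) / ((p + z) * (q + z')) := by
      simp only [cfEval]
      field_simp
    rw [e3]
    refine le_trans ?_ (le_abs_self _)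
    rw [div_le_div_iff₀ (by positivity) (by positivity)]
    have e4 : ((p : ℝ) + z) * (q + z') ≤ (3 * x) * (3 * x) :=
      mul_le_mul (by linarith [hz.2]) (by linarith [hz'.2]) e2.le (by linarith)
    have e5 : D / 2 ≤ (q + z') - (p + z) := by
      simp only [D] at hD2 ⊢; linarith [hz.2, hz'.1]
    calc D * ((p + z) * (q + z')) ≤ D * ((3 * x) * (3 * x)) := by gcongr
      _ = D / 2 * (18 * x ^ 2) := by ring
      _ ≤ _ := by gcongr
  have hD0 : 0 < D := by linarith
  have hlow : D * x ^ (-(1 + t)) / 18 ≤ (D / (18 * x ^ 2)) ^ t := by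
    rw [Real.div_rpow hD0.le (by positivity), Real.mul_rpow (by norm_num) (by positivity),
      ← Real.rpow_natCast x 2, ← Real.rpow_mul hx0.le]
    have a1 : (18 : ℝ) ^ t ≤ 18 := by
      simpa using Real.rpow_le_rpow_of_exponent_le (show (1 : ℝ) ≤ 18 by norm_num) ht1.le
    have a2 : D * x ^ (t - 1) ≤ D ^ t := by
      calc D * x ^ (t - 1) ≤ D * D ^ (t - 1) := by
            have := Real.rpow_le_rpow_of_nonpos hD0 hDx (show t - 1 ≤ 0 by linarith)
            gcongr
        _ = D ^ t := by
            nth_rw 1 [← Real.rpow_one D]; rw [← Real.rpow_add hD0]; congr 1; ring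
    rw [div_le_div_iff₀ (by norm_num) (by positivity)]
    calc D * x ^ (-(1 + t)) * (18 ^ t * x ^ (((2 : ℕ) : ℝ) * t))
        = (D * x ^ (t - 1)) * 18 ^ t := by
          have : x ^ (t - 1) = x ^ (-(1 + t)) * x ^ (((2 : ℕ) : ℝ) * t) := by
            rw [← Real.rpow_add hx0]; congr 1; push_cast; ring
          rw [this]; ring
      _ ≤ D ^ t * 18 := by gcongr
  have hcard0 : 0 < x ^ (1 - ε) := by positivity
  have hinv : ((primesBetween x).card : ℝ)⁻¹ ≤ (x ^ (1 - ε))⁻¹ := inv_anti₀ hcard0 hcard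
  rw [Finset.sum_const, Finset.card_image_of_injective _ hinj, nsmul_eq_mul]
  calc r * (S.card * ((primesBetween x).card : ℝ)⁻¹)
      ≤ x ^ (-(t + ε)) * (2 * D * (x ^ (1 - ε))⁻¹) := by gcongr
    _ = 36 * (D * x ^ (-(1 + t)) / 18) := by
        rw [← Real.rpow_neg hx0.le]
        have : x ^ (-(1 + t)) = x ^ (-(t + ε)) * x ^ (-(1 - ε)) := by
          rw [← Real.rpow_add hx0]; congr 1; ring
        rw [this]; ring
    _ ≤ 36 * (D / (18 * x ^ 2)) ^ t := by gcongr
    _ ≤ _ := by gcongr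

/-- Bookkeeping for the construction of points with prescribed prime digits. A stage consists of
`free` arbitrary words followed by one prime digit for each index `done`; `start` is the position
of the first prime digit of the stage and `length` is the number of digits already chosen. -/
structure BlockState where
  /-- The number of digits already chosen. -/
  length : ℕ
  /-- The position of the first prime digit of the current stage. -/
  start : ℕ
  /-- The number of arbitrary words still to be chosen in the current stage. -/
  free : ℕ
  /-- The number of prime digits already chosen in the current stage. -/
  done : ℕ

namespace BlockState

/-- The first state of a stage, when `E` digits have been chosen. -/
def reload (L : ℕ) (g : ℕ → ℕ) (E : ℕ) : BlockState := ⟨E, E + L * g E + 1, g E, 0⟩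

/-- The state after the next choice. -/
def next (l L : ℕ) (g : ℕ → ℕ) (σ : BlockState) : BlockState :=
  if 0 < σ.free then ⟨σ.length + L, σ.start, σ.free - 1, σ.done⟩
  else if σ.done + 1 < l then ⟨σ.length + 1, σ.start, 0, σ.done + 1⟩
  else reload L g (σ.length + 1)

/-- The words that may be chosen in a given state. -/
noncomputable def alphabet (W : Finset (List ℕ)) (A : ℕ → ℝ) (σ : BlockState) :
    Finset (List ℕ) :=
  if 0 < σ.free then W else (primesBetween (A σ.done ^ σ.start)).image fun p => [p]

/-- The probability of each of the words that may be chosen in a given state. -/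
noncomputable def weight (W : Finset (List ℕ)) (A : ℕ → ℝ) (t : ℝ) (σ : BlockState)
    (v : List ℕ) : ℝ :=
  if 0 < σ.free then cfDen v 0 ^ (-(2 * t)) / ∑ u ∈ W, cfDen u 0 ^ (-(2 * t))
  else ((primesBetween (A σ.done ^ σ.start)).card : ℝ)⁻¹

/-- A bound for the factor by which the ratio of the mass of a cylinder to the `t`-th power of its
diameter grows. -/
noncomputable def ratio (W : Finset (List ℕ)) (A : ℕ → ℝ) (t ε : ℝ) (σ : BlockState) : ℝ :=
  if 0 < σ.free then 4 ^ t / ∑ u ∈ W, cfDen u 0 ^ (-(2 * t))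
  else 16 * (A σ.done ^ σ.start) ^ (2 * t - 1 + ε)

/-- The invariant satisfied by the state and the accumulated product `r` of the ratios. -/
structure Valid (W : Finset (List ℕ)) (A : ℕ → ℝ) (l L : ℕ) (t ε : ℝ) (σ : BlockState)
    (r : ℝ) : Prop where
  done_lt : σ.done < l
  start_add_done : σ.start + σ.done = σ.length + L * σ.free + 1
  done_eq_zero : 0 < σ.free → σ.done = 0
  good : GoodIndex A l t ε σ.start
  pos : 0 < r
  le_one : r ≤ 1
  small : ∀ k, σ.done ≤ k → k < l → r * (4 ^ t / ∑ u ∈ W, cfDen u 0 ^ (-(2 * t))) ^ σ.free *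
    ∏ i ∈ Finset.Ico σ.done k, (16 * (A i ^ σ.start) ^ (2 * t - 1 + ε)) ≤
      (A k ^ σ.start) ^ (-(t + ε))

variable {W : Finset (List ℕ)} {A : ℕ → ℝ} {l L : ℕ} {t ε : ℝ} {g : ℕ → ℕ} {σ : BlockState} {r : ℝ}

theorem valid_reload (hl : 0 < l) (hA : ∀ i, 1 < A i)
    (hg : ∀ E, GoodIndex A l t ε (E + L * g E + 1) ∧ ∀ k < l,
      (4 ^ t / ∑ u ∈ W, cfDen u 0 ^ (-(2 * t))) ^ g E *
        ∏ i ∈ Finset.range k, (16 * (A i ^ (E + L * g E + 1)) ^ (2 * t - 1 + ε)) ≤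
          (A k ^ (E + L * g E + 1)) ^ (-(t + ε))) (hr0 : 0 < r) (hr1 : r ≤ 1) (E : ℕ) :
    (reload L g E).Valid W A l L t ε r where
  done_lt := hl
  start_add_done := rfl
  done_eq_zero := fun _ => rfl
  good := (hg E).1
  pos := hr0
  le_one := hr1
  small := fun k _ hk => by
    simp only [reload, Nat.Ico_zero_eq_range, mul_assoc]
    have h0 : 0 ≤ (A k ^ (E + L * g E + 1)) ^ (-(t + ε)) :=
      Real.rpow_nonneg (pow_pos (zero_lt_one.trans (hA k)) _).le _
    calc _ ≤ r * (A k ^ (E + L * g E + 1)) ^ (-(t + ε)) :=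
          mul_le_mul_of_nonneg_left ((hg E).2 k hk) hr0.le
      _ ≤ _ := mul_le_of_le_one_left h0 hr1

theorem Valid.rpow_bound (h : σ.Valid W A l L t ε r) (hf : ¬ 0 < σ.free) :
    r ≤ (A σ.done ^ σ.start) ^ (-(t + ε)) := by
  have := h.small σ.done le_rfl h.done_lt
  simpa [Nat.eq_zero_of_not_pos hf] using this

theorem Valid.ratio_pos (h : σ.Valid W A l L t ε r) (hW : 0 < ∑ u ∈ W, cfDen u 0 ^ (-(2 * t))) :
    0 < σ.ratio W A t ε := by
  rw [ratio]
  split_ifs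
  · positivity
  · have := (h.good _ h.done_lt).1
    have : 0 < A σ.done ^ σ.start := by linarith
    positivity

theorem Valid.next (h : σ.Valid W A l L t ε r) (hl : 0 < l) (hA : ∀ i, 1 < A i)
    (hW : 0 < ∑ u ∈ W, cfDen u 0 ^ (-(2 * t)))
    (hθ : 4 ^ t / ∑ u ∈ W, cfDen u 0 ^ (-(2 * t)) ≤ 1)
    (hg : ∀ E, GoodIndex A l t ε (E + L * g E + 1) ∧ ∀ k < l,
      (4 ^ t / ∑ u ∈ W, cfDen u 0 ^ (-(2 * t))) ^ g E *
        ∏ i ∈ Finset.range k, (16 * (A i ^ (E + L * g E + 1)) ^ (2 * t - 1 + ε)) ≤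
          (A k ^ (E + L * g E + 1)) ^ (-(t + ε))) :
    (σ.next l L g).Valid W A l L t ε (r * σ.ratio W A t ε) := by
  have hpos := mul_pos h.pos (h.ratio_pos hW)
  by_cases hf : 0 < σ.free
  · have hsucc : σ.free = σ.free - 1 + 1 := by omega
    have hnext : σ.next l L g = ⟨σ.length + L, σ.start, σ.free - 1, σ.done⟩ := if_pos hf
    have hratio : σ.ratio W A t ε = 4 ^ t / ∑ u ∈ W, cfDen u 0 ^ (-(2 * t)) := if_pos hf
    rw [hnext]
    refine ⟨h.done_lt, ?_, fun _ => h.done_eq_zero hf, h.good, hpos, ?_, fun k hk hkl => ?_⟩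
    · have := h.start_add_done
      rw [hsucc] at this
      simp only
      rw [this]; ring
    · rw [hratio]
      exact mul_le_one₀ h.le_one (by positivity) hθ
    · refine le_trans (le_of_eq ?_) (h.small k hk hkl)
      simp only
      rw [hratio]
      conv_rhs => rw [hsucc, pow_succ']
      ring
  have hratio : σ.ratio W A t ε = 16 * (A σ.done ^ σ.start) ^ (2 * t - 1 + ε) := if_neg hf
  have hgood := h.good _ h.done_lt
  have hx : 0 < A σ.done ^ σ.start := by linarith [hgood.1]
  have hle : r * σ.ratio W A t ε ≤ 1 := by
    calc r * σ.ratio W A t ε ≤ (A σ.done ^ σ.start) ^ (-(t + ε)) *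
          (16 * (A σ.done ^ σ.start) ^ (2 * t - 1 + ε)) := by
            rw [hratio]; exact mul_le_mul_of_nonneg_right (h.rpow_bound hf) (by positivity)
      _ = 16 * (A σ.done ^ σ.start) ^ (t - 1) := by
            rw [mul_left_comm, ← Real.rpow_add hx]; congr 2; ring
      _ ≤ 1 := hgood.2.2
  by_cases hd : σ.done + 1 < l
  · have hnext : σ.next l L g = ⟨σ.length + 1, σ.start, 0, σ.done + 1⟩ := by
      rw [BlockState.next, if_neg hf, if_pos hd]
    rw [hnext]
    refine ⟨hd, ?_, fun h => absurd h (lt_irrefl 0), h.good, hpos, hle, fun k hk hkl => ?_⟩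
    · have := h.start_add_done
      rw [Nat.eq_zero_of_not_pos hf] at this
      simp only
      omega
    · refine le_trans (le_of_eq ?_) (h.small k (by simp only at hk; omega) hkl)
      simp only at hk ⊢
      rw [hratio, Nat.eq_zero_of_not_pos hf,
        Finset.prod_eq_prod_Ico_succ_bot (show σ.done < k by omega)]
      ring
  · have hnext : σ.next l L g = reload L g (σ.length + 1) := by
      rw [BlockState.next, if_neg hf, if_neg hd]
    rw [hnext]
    exact valid_reload hl hA hg hpos hle _

theorem length_next {v : List ℕ} (hWL : ∀ v ∈ W, v.length = L) (hv : v ∈ σ.alphabet W A) :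
    (σ.next l L g).length = σ.length + v.length := by
  by_cases hf : 0 < σ.free
  · rw [alphabet, if_pos hf] at hv
    rw [BlockState.next, if_pos hf, hWL v hv]
  · rw [alphabet, if_neg hf] at hv
    obtain ⟨p, -, rfl⟩ := Finset.mem_image.1 hv
    rw [BlockState.next, if_neg hf]
    split_ifs <;> rfl

theorem exists_iterate_next_free_eq_zero (hd : σ.done = 0) :
    ∃ m, ((next l L g)^[m] σ).free = 0 ∧ ((next l L g)^[m] σ).done = 0 := by
  induction hf : σ.free generalizing σ with
  | zero => exact ⟨0, hf, hd⟩
  | succ f ih =>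
    have hnext : σ.next l L g = ⟨σ.length + L, σ.start, σ.free - 1, σ.done⟩ :=
      if_pos (by omega)
    obtain ⟨m, hm⟩ := ih (σ := σ.next l L g) (by rw [hnext]; exact hd) (by rw [hnext]; simp [hf])
    exact ⟨m + 1, hm⟩

theorem exists_iterate_next_done_eq_zero (hf : 0 < σ.free → σ.done = 0) :
    ∃ m, ((next l L g)^[m] σ).done = 0 := by
  induction hk : l - σ.done generalizing σ with
  | zero =>
    by_cases hfree : 0 < σ.free
    · exact ⟨0, hf hfree⟩
    · refine ⟨1, ?_⟩
      show (σ.next l L g).done = 0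
      rw [BlockState.next, if_neg hfree, if_neg (by omega)]
      rfl
  | succ j ih =>
    by_cases hfree : 0 < σ.free
    · exact ⟨0, hf hfree⟩
    by_cases hd : σ.done + 1 < l
    · have hnext : σ.next l L g = ⟨σ.length + 1, σ.start, 0, σ.done + 1⟩ := by
        rw [BlockState.next, if_neg hfree, if_pos hd]
      obtain ⟨m, hm⟩ := ih (σ := σ.next l L g)
        (by rw [hnext]; intro h; exact absurd h (lt_irrefl 0))
        (by rw [hnext]; show l - (σ.done + 1) = j; omega)
      exact ⟨m + 1, hm⟩
    · refine ⟨1, ?_⟩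
      show (σ.next l L g).done = 0
      rw [BlockState.next, if_neg hfree, if_neg hd]
      rfl

theorem iterate_next_of_free_eq_zero (hf : σ.free = 0) (hd : σ.done = 0) {i : ℕ} (hi : i < l) :
    (next l L g)^[i] σ = ⟨σ.length + i, σ.start, 0, i⟩ := by
  induction i with
  | zero =>
    cases σ
    simp only at hf hd
    subst hf hd
    rfl
  | succ i ih =>
    rw [Function.iterate_succ_apply', ih (by omega), BlockState.next, if_neg (by simp), if_pos hi]
    rfl

theorem Valid.card_pos (h : σ.Valid W A l L t ε r) :
    (0 : ℝ) < (primesBetween (A σ.done ^ σ.start)).card := by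
  obtain ⟨hx, hc, -⟩ := h.good _ h.done_lt
  exact (Real.rpow_pos_of_pos (by linarith) _).trans_le hc

theorem Valid.mem_alphabet (h : σ.Valid W A l L t ε r) (hL : L ≠ 0)
    (hWL : ∀ v ∈ W, v.length = L ∧ ∀ a ∈ v, 1 ≤ a) {v : List ℕ} (hv : v ∈ σ.alphabet W A) :
    v ≠ [] ∧ ∀ a ∈ v, 1 ≤ a := by
  by_cases hf : 0 < σ.free
  · rw [alphabet, if_pos hf] at hv
    refine ⟨fun hv0 => hL ?_, (hWL v hv).2⟩
    rw [← (hWL v hv).1, hv0, List.length_nil]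
  · rw [alphabet, if_neg hf] at hv
    obtain ⟨p, hp, rfl⟩ := Finset.mem_image.1 hv
    have hx := (h.good _ h.done_lt).1
    have := ((mem_primesBetween (by linarith)).1 hp).1.one_lt.le
    simpa using this

theorem weight_nonneg (v : List ℕ) : 0 ≤ σ.weight W A t v := by
  rw [weight]
  split_ifs
  · exact div_nonneg (Real.rpow_nonneg (cfDen_nonneg v) _)
      (Finset.sum_nonneg fun u _ => Real.rpow_nonneg (cfDen_nonneg u) _)
  · positivity

theorem Valid.sum_weight (h : σ.Valid W A l L t ε r)
    (hW : 0 < ∑ u ∈ W, cfDen u 0 ^ (-(2 * t))) :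
    ∑ v ∈ σ.alphabet W A, σ.weight W A t v = 1 := by
  by_cases hf : 0 < σ.free
  · simp only [weight, alphabet, if_pos hf]
    rw [← Finset.sum_div, div_self hW.ne']
  · simp only [weight, alphabet, if_neg hf]
    rw [Finset.sum_const, Finset.card_image_of_injective _ fun p q h => by simpa using h,
      nsmul_eq_mul, mul_inv_cancel₀ h.card_pos.ne']

theorem Valid.weight_mul_le_ratio (h : σ.Valid W A l L t ε r) (ht : 0 < t) (ht1 : t < 1)
    (hW1 : ∀ v ∈ W, ∀ a ∈ v, 1 ≤ a) {v : List ℕ} (hv : v ∈ σ.alphabet W A) :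
    σ.weight W A t v * (2 * cfDen v 0) ^ (2 * t) ≤ σ.ratio W A t ε := by
  by_cases hf : 0 < σ.free
  · simp only [weight, ratio, alphabet, if_pos hf] at hv ⊢
    have hq : 0 < cfDen v 0 := zero_lt_one.trans_le (one_le_cfDen (hW1 v hv) (by simp))
    rw [Real.mul_rpow (by norm_num) hq.le, Real.rpow_mul (by norm_num), div_mul_eq_mul_div,
      mul_left_comm, ← Real.rpow_add hq]
    norm_num
  · simp only [weight, ratio, alphabet, if_neg hf] at hv ⊢
    obtain ⟨p, hp, rfl⟩ := Finset.mem_image.1 hv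
    obtain ⟨hx, hc, -⟩ := h.good _ h.done_lt
    set x := A σ.done ^ σ.start
    have hx0 : 0 < x := by linarith
    obtain ⟨-, hp1, hp2⟩ := (mem_primesBetween hx0.le).1 hp
    have hp0 : 0 ≤ (p : ℝ) := p.cast_nonneg
    have hden : cfDen [p] 0 = p := by simp [cfDen, cfEval]
    have h16 : (4 : ℝ) ^ (2 * t) ≤ 16 := by
      calc (4 : ℝ) ^ (2 * t) ≤ 4 ^ (2 : ℝ) :=
            Real.rpow_le_rpow_of_exponent_le (by norm_num) (by linarith)
        _ = 16 := by norm_num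
    rw [hden]
    calc _ ≤ (x ^ (1 - ε))⁻¹ * (4 * x) ^ (2 * t) := by
          gcongr ?_ * ?_
          · exact inv_anti₀ (by positivity) hc
          · exact Real.rpow_le_rpow (by positivity) (by linarith) (by linarith)
      _ = 4 ^ (2 * t) * x ^ (2 * t - 1 + ε) := by
          rw [Real.mul_rpow (by norm_num) hx0.le, ← Real.rpow_neg hx0.le, mul_left_comm,
            ← Real.rpow_add hx0]
          congr 2; ring
      _ ≤ _ := by gcongr

theorem Valid.exists_separated (h : σ.Valid W A l L t ε r) (ht : 0 < t) (ht1 : t < 1)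
    (hW : 0 < ∑ u ∈ W, cfDen u 0 ^ (-(2 * t)))
    {δ : ℝ} (hδ : 0 < δ) (hsep : ∀ v ∈ W, ∀ v' ∈ W, v ≠ v' → ∀ z ∈ Icc (0 : ℝ) 1,
      ∀ z' ∈ Icc (0 : ℝ) 1, δ ≤ |cfEval v z - cfEval v' z'|)
    {B : Finset (List ℕ)} (hB : B ⊆ σ.alphabet W A) (hnt : B.Nontrivial) :
    ∃ v ∈ B, ∃ v' ∈ B, ∀ z ∈ Icc (0 : ℝ) 1, ∀ z' ∈ Icc (0 : ℝ) 1,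
      r * ∑ u ∈ B, σ.weight W A t u ≤ (36 + (δ ^ t)⁻¹) * |cfEval v z - cfEval v' z'| ^ t := by
  have hδt : 0 < δ ^ t := Real.rpow_pos_of_pos hδ t
  by_cases hf : 0 < σ.free
  · have hBW : B ⊆ W := by rwa [alphabet, if_pos hf] at hB
    obtain ⟨v, hv, v', hv', hne⟩ := hnt
    refine ⟨v, hv, v', hv', fun z hz z' hz' => ?_⟩
    have hd := Real.rpow_le_rpow hδ.le (hsep v (hBW hv) v' (hBW hv') hne z hz z' hz') ht.le
    have h1 : ∑ u ∈ B, σ.weight W A t u ≤ 1 := by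
      rw [← h.sum_weight hW]
      exact Finset.sum_le_sum_of_subset_of_nonneg hB fun u _ _ => weight_nonneg u
    have h0 : 0 ≤ ∑ u ∈ B, σ.weight W A t u :=
      Finset.sum_nonneg fun u _ => weight_nonneg u
    calc _ ≤ 1 := mul_le_one₀ h.le_one h0 h1
      _ = (δ ^ t)⁻¹ * δ ^ t := (inv_mul_cancel₀ hδt.ne').symm
      _ ≤ _ := by
        gcongr
        linarith
  · obtain ⟨hx, hc, -⟩ := h.good _ h.done_lt
    rw [alphabet, if_neg hf] at hB
    obtain ⟨v, hv, v', hv', hvv⟩ :=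
      exists_prime_words_separated hx ht ht1 (h.rpow_bound hf) hc hB hnt
    refine ⟨v, hv, v', hv', fun z hz z' hz' => ?_⟩
    simp only [weight, if_neg hf]
    refine (hvv z hz z' hz').trans (mul_le_mul_of_nonneg_right ?_ (by positivity))
    linarith [inv_pos.2 hδt]

theorem frequently_prime_digits (hWL : ∀ v ∈ W, v.length = L ∧ ∀ a ∈ v, 1 ≤ a)
    {ρ : ℕ → ℝ} (hV : ∀ m, ((next l L g)^[m] (reload L g 0)).Valid W A l L t ε (ρ m))
    (hL : L ≠ 0) {a : ℕ → List ℕ}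
    (ha : ∀ m, a m ∈ ((next l L g)^[m] (reload L g 0)).alphabet W A) {x : ℝ}
    (hx : ∀ m, ∃ z ∈ Ioo (0 : ℝ) 1, x = cfEval (wordPrefix a m) z) :
    ∃ᶠ n in atTop, ∀ i < l, (cfA x (n + i)).Prime ∧ A i ^ n ≤ cfA x (n + i) ∧
      (cfA x (n + i) : ℝ) ≤ 2 * A i ^ n := by
  set st : ℕ → BlockState := fun m => (next l L g)^[m] (reload L g 0) with hst
  have hadd : ∀ i m, st (m + i) = (next l L g)^[i] (st m) := fun i m => by
    simp only [hst]; rw [add_comm, Function.iterate_add_apply]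
  have hmem : ∀ m, a m ≠ [] ∧ ∀ b ∈ a m, 1 ≤ b := fun m => (hV m).mem_alphabet hL hWL (ha m)
  have hlen : ∀ m, (st m).length = (wordPrefix a m).length := by
    intro m
    induction m with
    | zero => rfl
    | succ m ih =>
      have hs : st (m + 1) = (st m).next l L g := hadd 1 m
      rw [hs, length_next (fun v hv => (hWL v hv).1) (ha m), wordPrefix, List.length_append, ih]
  rw [frequently_atTop]
  intro M
  obtain ⟨m₁, h₁⟩ := exists_iterate_next_done_eq_zero (l := l) (L := L) (g := g)
    (hV M).done_eq_zero
  obtain ⟨m₂, hf, hd⟩ := exists_iterate_next_free_eq_zero (l := l) (L := L) (g := g) h₁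
  rw [← hadd m₁ M, ← hadd] at hf hd
  set m := M + m₁ + m₂
  have hstart : (st m).start = (st m).length + 1 := by
    have := (hV m).start_add_done
    change (st m).start + (st m).done = _ + L * (st m).free + 1 at this
    rw [hf, hd] at this
    simpa using this
  have hmM : M ≤ (st m).start := by
    have := le_length_wordPrefix (fun m => (hmem m).1) m
    rw [← hlen] at this
    omega
  refine ⟨(st m).start, hmM, fun i hi => ?_⟩
  have hsti : st (m + i) = ⟨(st m).length + i, (st m).start, 0, i⟩ :=
    (hadd i m).trans (iterate_next_of_free_eq_zero hf hd hi)
  have hai := ha (m + i)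
  change a (m + i) ∈ (st (m + i)).alphabet W A at hai
  rw [hsti, alphabet, if_neg (lt_irrefl 0)] at hai
  obtain ⟨p, hp, hpa⟩ := Finset.mem_image.1 hai
  obtain ⟨z, hz, hxz⟩ := hx (m + i + 1)
  have hlen' := hlen (m + i)
  rw [hsti] at hlen'
  have hp1 := one_le_of_mem_wordPrefix (fun m => (hmem m).2) (m + i + 1)
  rw [wordPrefix, ← hpa] at hxz hp1
  have hdigit : cfA x ((st m).start + i) = p := by
    have := cfA_cfEval_append hp1 hz
    rw [← hxz, ← hlen'] at this
    rw [hstart, ← this]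
    congr 1
    show _ = (st m).length + i + 1
    ring
  rw [hdigit]
  have hx2 := ((hV m).good i hi).1
  exact (mem_primesBetween (by change 2 < A i ^ (st m).start at hx2; linarith)).1 hp

end BlockState

theorem exists_pos_mul_rpow_lt_one {A : ℕ → ℝ} (hA : ∀ i, 1 < A i) (l : ℕ) {t γ : ℝ}
    (hγ : ∀ k < l, γ < growthRate A k t) :
    ∃ ε > 0, ∀ k < l, γ * A k ^ (t + ε) * (∏ i ∈ Finset.range k, A i) ^ (2 * t - 1 + ε) < 1 := by
  have h : ∀ k, ∀ᶠ ε : ℝ in 𝓝[>] 0, k < l →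
      γ * A k ^ (t + ε) * (∏ i ∈ Finset.range k, A i) ^ (2 * t - 1 + ε) < 1 := by
    intro k
    by_cases hk : k < l
    · have hk0 := zero_lt_one.trans (hA k)
      have hP := prod_pos_of_one_lt hA k
      have hcont : Continuous fun ε : ℝ =>
          γ * A k ^ (t + ε) * (∏ i ∈ Finset.range k, A i) ^ (2 * t - 1 + ε) := by
        have h1 : Continuous fun ε : ℝ => A k ^ (t + ε) :=
          (Real.continuous_const_rpow hk0.ne').comp (continuous_const.add continuous_id)
        have h2 : Continuous fun ε : ℝ => (∏ i ∈ Finset.range k, A i) ^ (2 * t - 1 + ε) :=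
          (Real.continuous_const_rpow hP.ne').comp (continuous_const.add continuous_id)
        exact (continuous_const.mul h1).mul h2
      have h0 : γ * A k ^ (t + 0) * (∏ i ∈ Finset.range k, A i) ^ (2 * t - 1 + 0) < 1 := by
        have h1 : A k ^ t * (∏ i ∈ Finset.range k, A i) ^ (2 * t - 1) * growthRate A k t = 1 := by
          rw [growthRate, mul_mul_mul_comm, mul_comm (A k ^ t), ← mul_mul_mul_comm,
            ← Real.rpow_add hP,
            mul_comm, ← Real.rpow_add hk0]
          simp
        rw [add_zero, add_zero, mul_assoc, mul_comm]
        exact (mul_lt_mul_of_pos_left (hγ k hk) (by positivity)).trans_eq h1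
      filter_upwards [nhdsWithin_le_nhds (hcont.continuousAt.eventually_lt_const h0)] with ε hε _
      exact hε
    · exact Eventually.of_forall fun _ h => absurd h hk
  obtain ⟨ε, hε, hε0⟩ :=
    (((Finset.range l).eventually_all.2 fun k _ => h k).and self_mem_nhdsWithin).exists
  exact ⟨ε, hε0, fun k hk => hε k (Finset.mem_range.2 hk) hk⟩

theorem le_dimH_of_frequently_prime {A : ℕ → ℝ} (hA : ∀ i, 1 < A i) {l : ℕ} (hl : 0 < l) {s : ℝ≥0}
    (hs : 0 < s) (hs1 : s < 1) {lam γ₀ : ℝ} (hlam : 1 < lam) (hγ₀ : 0 < γ₀)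
    (h : ∀ N ≠ 0, ENNReal.ofReal (lam ^ N) ≤ 4 * cfSum N s * ENNReal.ofReal (γ₀ ^ N))
    (hγA : ∀ k < l, γ₀ ≤ growthRate A k s) {X : Set ℝ}
    (hX : ∀ x ∈ Ioo (0 : ℝ) 1, Irrational x → (∃ᶠ n in atTop, ∀ i < l, (cfA x (n + i)).Prime ∧
      A i ^ n ≤ cfA x (n + i) ∧ (cfA x (n + i) : ℝ) ≤ 2 * A i ^ n) → x ∈ X) :
    (s : ℝ≥0∞) ≤ dimH X := by
  obtain ⟨t, hst⟩ : ∃ t : ℝ, (s : ℝ) = t := ⟨s, rfl⟩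
  rw [hst] at h hγA
  have ht : 0 < t := hst ▸ NNReal.coe_pos.2 hs
  have ht1 : t < 1 := by rw [← hst]; exact_mod_cast hs1
  obtain ⟨L, hL, W, hWL, hZ, δ, hδ, hsep⟩ := exists_separated_words ht ht1.le hlam hγ₀ h
  have hW1 : ∀ v ∈ W, ∀ a ∈ v, 1 ≤ a := fun v hv => (hWL v hv).2
  have hsq : 1 < √lam := Real.lt_sqrt_of_sq_lt (by linarith)
  have hγlt : γ₀ / √lam < γ₀ := div_lt_self hγ₀ hsq
  have hγ : 0 < γ₀ / √lam := by positivity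
  have hγ1 : γ₀ / √lam ≤ 1 := by
    have h0 : growthRate A 0 t ≤ 1 := by
      simpa [growthRate] using Real.rpow_le_one_of_one_le_of_nonpos (hA 0).le (by linarith)
    exact (hγlt.le.trans (hγA 0 hl)).trans h0
  have hW : 0 < ∑ u ∈ W, cfDen u 0 ^ (-(2 * t)) :=
    pos_of_mul_pos_right ((Real.rpow_pos_of_pos (by norm_num) t).trans_le hZ) (by positivity)
  have hθγ : 4 ^ t / ∑ u ∈ W, cfDen u 0 ^ (-(2 * t)) ≤ (γ₀ / √lam) ^ L := (div_le_iff₀ hW).2 hZ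
  have hθ1 := hθγ.trans (pow_le_one₀ hγ.le hγ1)
  obtain ⟨ε, hε, hρ⟩ := exists_pos_mul_rpow_lt_one hA l fun k hk => hγlt.trans_le (hγA k hk)
  choose g hg using exists_free_count hA l ht1 hε hγ (by positivity) hL hθγ hρ
  set st : ℕ → BlockState := fun m => (BlockState.next l L g)^[m] (BlockState.reload L g 0)
  set r : ℕ → ℝ := fun m => ∏ i ∈ Finset.range m, (st i).ratio W A t ε with hr
  have hV : ∀ m, (st m).Valid W A l L t ε (r m) := by
    intro m
    induction m with
    | zero => exact BlockState.valid_reload hl hA hg zero_lt_one le_rfl 0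
    | succ m ih =>
      simp only [hr, st, Finset.prod_range_succ, Function.iterate_succ_apply']
      exact ih.next hl hA hW hθ1 hg
  refine le_dimH_of_forall_words_mem (𝒜 := fun m => (st m).alphabet W A)
    (w := fun m => (st m).weight W A t) (r := r) (C := 36 + (δ ^ t)⁻¹) hst ht (by positivity)
    (fun m v hv => (hV m).mem_alphabet hL hWL hv) (fun m v => BlockState.weight_nonneg v)
    (fun m => (hV m).sum_weight hW)
    (by simp [hr]) (fun m v hv => ?_) (fun m => (hV m).le_one)
    (fun m B hB hnt => (hV m).exists_separated ht ht1 hW hδ hsep hB hnt)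
    (fun a ha x hx hirr hxa => hX x hx hirr ?_)
  · simp only [hr, Finset.prod_range_succ]
    exact mul_le_mul_of_nonneg_left ((hV m).weight_mul_le_ratio ht ht1 hW1 hv) (hV m).pos.le
  · exact BlockState.frequently_prime_digits hWL hV hL ha hxa

theorem growthRate_le_mul {A : ℕ → ℝ} (hA : ∀ i, 1 < A i) (k : ℕ) {s t : ℝ} (hts : t ≤ s) :
    growthRate A k s ≤ growthRate A k t / A k ^ (s - t) := by
  have hk := zero_lt_one.trans (hA k)
  have hP : 1 ≤ ∏ i ∈ Finset.range k, A i := by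
    simpa using Finset.prod_le_prod (s := Finset.range k) (f := fun _ => (1 : ℝ))
      (fun _ _ => zero_le_one) fun i _ => (hA i).le
  rw [growthRate, growthRate, mul_div_assoc, ← Real.rpow_sub hk]
  have : -t - (s - t) = -s := by ring
  rw [this]
  exact mul_le_mul_of_nonneg_right (Real.rpow_le_rpow_of_exponent_le hP (by linarith))
    (by positivity)

theorem cfSum_anti (n : ℕ) {s t : ℝ} (hts : t ≤ s) : cfSum n s ≤ cfSum n t :=
  ENNReal.tsum_le_tsum fun u => ENNReal.ofReal_le_ofReal <|
    Real.rpow_le_rpow_of_exponent_le (one_le_cfDen_pnatWord u) (by linarith)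

theorem Sprimeℓ_subset_Sℓ {ℓ : ℕ} {A : Fin ℓ → ℝ} (hA : ∀ i, 1 < A i) :
    Sprimeℓ ℓ A ⊆ Sℓ ℓ A := by
  rintro x ⟨hx, hirr, hinf⟩
  refine ⟨hx, hirr, hinf.mono fun n hn => ⟨hn.1, fun i => ?_⟩⟩
  have h := hn.2 i
  have : cfA' x (n + i) = cfA x (n + i) := by
    rw [cfA', if_pos]
    by_contra hp
    rw [cfA', if_neg hp] at h
    have := pow_pos (zero_lt_one.trans (hA i)) n
    have := h.1
    push_cast at this
    linarith
  rwa [this] at h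

theorem dimH_le_dimH_of_frequently {A : ℕ → ℝ} (hA : ∀ i, 1 < A i) {l : ℕ} (hl : 0 < l)
    {X Y : Set ℝ}
    (hX : ∀ x ∈ X, x ∈ Ioo (0 : ℝ) 1 ∧ Irrational x ∧ ∃ᶠ n in atTop, ∀ i < l,
      A i ^ (n + 1) ≤ cfA x (n + 1 + i) ∧ (cfA x (n + 1 + i) : ℝ) ≤ 2 * A i ^ (n + 1))
    (hY : ∀ x ∈ Ioo (0 : ℝ) 1, Irrational x → (∃ᶠ n in atTop, ∀ i < l, (cfA x (n + i)).Prime ∧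
      A i ^ n ≤ cfA x (n + i) ∧ (cfA x (n + i) : ℝ) ≤ 2 * A i ^ n) → x ∈ Y) :
    dimH X ≤ dimH Y := by
  refine ENNReal.le_of_forall_nnreal_lt fun t htX => ?_
  rcases eq_or_ne t 0 with rfl | ht0
  · simp
  have ht : 0 < t := pos_iff_ne_zero.2 ht0
  obtain ⟨s, hts, hsX⟩ := ENNReal.lt_iff_exists_nnreal_btwn.1 htX
  have hts : t < s := by exact_mod_cast hts
  have hts' : (t : ℝ) < s := by exact_mod_cast hts
  have hs1 : s < 1 := by
    have : dimH X ≤ 1 := (dimH_mono (subset_univ X)).trans Real.dimH_univ.le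
    exact_mod_cast hsX.trans_le this
  have hs1' : (s : ℝ) ≤ 1 := by exact_mod_cast hs1.le
  have key : ∀ k < l, ∀ N ≠ 0, 1 ≤
      ENNReal.ofReal (4 ^ (s : ℝ)) * cfSum N s * ENNReal.ofReal (growthRate A k s) ^ N := by
    intro k hk N hN
    by_contra! hlt
    refine hsX.not_ge (dimH_le_of_frequently_mem hA (ht.trans hts) hN hlt fun x hx => ?_)
    obtain ⟨h0, h1, h2⟩ := hX x hx
    exact ⟨h0, h1, h2.mono fun n hn i hi => hn i (hi.trans_lt hk)⟩
  obtain ⟨k, hk, hmin⟩ := Finset.exists_min_image (Finset.range l) (fun k => growthRate A k t)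
    ⟨0, Finset.mem_range.2 hl⟩
  have hk0 := zero_lt_one.trans (hA k)
  have hγ := growthRate_pos hA k t
  refine le_dimH_of_frequently_prime hA hl ht (hts.trans hs1)
    (Real.one_lt_rpow (hA k) (sub_pos.2 hts')) hγ (fun N hN => ?_)
    (fun j hj => hmin j (Finset.mem_range.2 hj)) hY
  set lam := A k ^ ((s : ℝ) - t)
  have hlam : 0 < lam := by positivity
  have hlam0 : lam ≠ 0 := hlam.ne'
  have h4 : ENNReal.ofReal (4 ^ (s : ℝ)) ≤ 4 := by
    rw [ENNReal.ofReal_le_iff_le_toReal (by simp)]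
    calc (4 : ℝ) ^ (s : ℝ) ≤ 4 ^ (1 : ℝ) := Real.rpow_le_rpow_of_exponent_le (by norm_num) hs1'
      _ = _ := by simp
  calc ENNReal.ofReal (lam ^ N)
      ≤ ENNReal.ofReal (lam ^ N) * (ENNReal.ofReal (4 ^ (s : ℝ)) * cfSum N s *
        ENNReal.ofReal (growthRate A k s) ^ N) :=
        le_mul_of_one_le_right zero_le (key k (Finset.mem_range.1 hk) N hN)
    _ ≤ ENNReal.ofReal (lam ^ N) * (4 * cfSum N t *
        ENNReal.ofReal (growthRate A k t / lam) ^ N) := by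
        gcongr
        · exact cfSum_anti N hts'.le
        · exact growthRate_le_mul hA k hts'.le
    _ = 4 * cfSum N t * ENNReal.ofReal (growthRate A k t ^ N) := by
        rw [← ENNReal.ofReal_pow (by positivity), mul_left_comm,
          ← ENNReal.ofReal_mul (by positivity), ← mul_pow, mul_div_cancel₀ _ hlam0]

/-- **Proposition.** For any `ℓ ≥ 1` and reals `A_0, …, A_{ℓ-1} > 1`, the sets
`S_ℓ(A_0, …, A_{ℓ-1})` and `S′_ℓ(A_0, …, A_{ℓ-1})` have the same Hausdorff dimension. -/
theorem dimH_Sℓ_eq_dimH_Sprimeℓ (ℓ : ℕ) (hℓ : 1 ≤ ℓ) (A : Fin ℓ → ℝ) (hA : ∀ i, 1 < A i) :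
    dimH (Sℓ ℓ A) = dimH (Sprimeℓ ℓ A) := by
  refine le_antisymm ?_ (dimH_mono (Sprimeℓ_subset_Sℓ hA))
  set B : ℕ → ℝ := fun i => if h : i < ℓ then A ⟨i, h⟩ else 2 with hB
  have hBA : ∀ i : Fin ℓ, B i = A i := fun i => dif_pos i.2
  have hB1 : ∀ i, 1 < B i := fun i => by
    simp only [hB]
    split_ifs
    exacts [hA _, one_lt_two]
  refine dimH_le_dimH_of_frequently hB1 hℓ ?_ ?_
  · rintro x ⟨hx, hirr, hinf⟩
    refine ⟨⟨hx.1.lt_of_ne' hirr.ne_zero, hx.2.lt_of_ne hirr.ne_one⟩, hirr, ?_⟩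
    rw [frequently_atTop]
    intro M
    obtain ⟨n, ⟨-, hn⟩, hMn⟩ := hinf.exists_gt M
    obtain ⟨m, rfl⟩ : ∃ m, n = m + 1 := ⟨n - 1, by omega⟩
    refine ⟨m, by omega, fun i hi => ?_⟩
    have := hn ⟨i, hi⟩
    rwa [← hBA] at this
  · intro x hx hirr hfreq
    refine ⟨Ioo_subset_Icc_self hx, hirr, Nat.frequently_atTop_iff_infinite.1 ?_⟩
    refine (hfreq.and_eventually (eventually_ge_atTop 1)).mono fun n hn => ⟨hn.2, fun i => ?_⟩
    obtain ⟨hp, h⟩ := hn.1 i i.2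
    rw [cfA', if_pos hp, ← hBA]
    exact h
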